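/- arXiv:2005.08878 — 2 statements merged into one kernel-verified Lean document; each statement's English description precedes it below -/
import Mathlib

section
/- Let K be an algebraic function field over a field k whose field of constants equals k. Let k(x) denote the rational function field in one variable over k and K(x) the rational function field in one variable over K, regarded as an algebraic function field over k(x) via the natural inclusion k(x) ⊆ K(x). Then cvg_{k(x)}(K(x)) = cvg_k(K). -/
universe u v

/-- `K` is an algebraic function field over `k`, i.e. a finitely generated field extension. -/
def IsAlgFunctionField (k : Type u) (K : Type v) [Field k] [Field K] [Algebra k K] : Prop :=
  (⊤ : IntermediateField k K).FG

/-- There is a covering diagram for `K/k` of degree `e`: algebraic function fields `K_B`, `K_C`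
over `k`, a `k`-algebra embedding `K ↪ K_C` which is module-finite, and a `k`-algebra
embedding `K_B(t) ↪ K_C` with `[K_C : K_B(t)] = e`. -/
def HasCvgDiagram (k : Type u) (K : Type v) [Field k] [Field K] [Algebra k K] (e : ℕ) : Prop :=
  ∃ (K_B K_C : Type (max u v)) (_ : Field K_B) (_ : Field K_C)
    (_ : Algebra k K_B) (_ : Algebra k K_C),
    IsAlgFunctionField k K_B ∧ IsAlgFunctionField k K_C ∧
    ∃ (f : K →ₐ[k] K_C) (π : RatFunc K_B →ₐ[k] K_C),
      f.toRingHom.Finite ∧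
      (letI := π.toRingHom.toAlgebra
       Module.finrank (RatFunc K_B) K_C = e)

/-- A covering diagram with `K_C/K` moreover separable. -/
def HasSepCvgDiagram (k : Type u) (K : Type v) [Field k] [Field K] [Algebra k K] (e : ℕ) :
    Prop :=
  ∃ (K_B K_C : Type (max u v)) (_ : Field K_B) (_ : Field K_C)
    (_ : Algebra k K_B) (_ : Algebra k K_C),
    IsAlgFunctionField k K_B ∧ IsAlgFunctionField k K_C ∧
    ∃ (f : K →ₐ[k] K_C) (π : RatFunc K_B →ₐ[k] K_C),
      f.toRingHom.Finite ∧
      (letI := f.toRingHom.toAlgebra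
       Algebra.IsSeparable K K_C) ∧
      (letI := π.toRingHom.toAlgebra
       Module.finrank (RatFunc K_B) K_C = e)

/-- The covering gonality of `K` over `k`. -/
noncomputable def cvg (k : Type u) (K : Type v) [Field k] [Field K] [Algebra k K] : ℕ :=
  sInf {e : ℕ | 0 < e ∧ HasCvgDiagram k K e}

/-- The separable covering gonality of `K` over `k`. -/
noncomputable def scvg (k : Type u) (K : Type v) [Field k] [Field K] [Algebra k K] : ℕ :=
  sInf {e : ℕ | 0 < e ∧ HasSepCvgDiagram k K e}

open scoped nonZeroDivisors

/-- The `k[X]`-nonzerodivisors map to `K[X]`-nonzerodivisors under an injective map. -/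
theorem polyMap_nonZeroDivisors_le (k : Type u) (K : Type v) [Field k] [Field K]
    [Algebra k K] :
    (Polynomial k)⁰ ≤ (Polynomial K)⁰.comap (Polynomial.mapRingHom (algebraMap k K)) := by
  intro p hp
  simp only [Submonoid.mem_comap, Polynomial.coe_mapRingHom]
  rw [mem_nonZeroDivisors_iff_ne_zero] at hp ⊢
  intro h
  exact hp ((Polynomial.map_eq_zero_iff (algebraMap k K).injective).mp h)

/-- The natural inclusion `k(x) ⊆ K(x)` of rational function fields. -/
noncomputable def ratFuncAlgebra (k : Type u) (K : Type v) [Field k] [Field K] [Algebra k K] :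
    Algebra (RatFunc k) (RatFunc K) :=
  (RatFunc.mapRingHom (Polynomial.mapRingHom (algebraMap k K))
    (polyMap_nonZeroDivisors_le k K)).toAlgebra

attribute [local instance] ratFuncAlgebra

open Polynomial



theorem aux_rank_le_of_lift {R F E κF κ : Type*} [CommRing R] [IsDomain R] [Field F] [Algebra R F]
    [IsFractionRing R F] [Field E] [Algebra R E] [Algebra F E] [IsScalarTower R F E]
    [FiniteDimensional F E] [Field κF] [Field κ] [Algebra κF κ]
    (O : ValuationSubring E) (ρ : O →+* κ) (hρ : Function.Surjective ρ)
    (H : ∀ (s : Finset κ) (a : s → R), a ≠ 0 → ∃ (c : E) (b : s → κF), b ≠ 0 ∧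
      ∀ i, ∃ h : c * algebraMap R E (a i) ∈ O, ρ ⟨_, h⟩ = algebraMap κF κ (b i)) :
    Module.rank κF κ ≤ (Module.finrank F E : ℕ) := by
  classical
  refine rank_le fun s hs => ?_
  choose u hu using hρ
  have key : LinearIndependent R (fun i : s => (u i.1 : E)) := by
    rw [Fintype.linearIndependent_iff]
    intro a ha
    by_contra hcon
    have ha0 : a ≠ 0 := fun h => hcon (fun i => congrFun h i)
    obtain ⟨c, b, hb, hcb⟩ := H s a ha0
    choose h hh using hcb
    apply hb
    rw [Fintype.linearIndependent_iff] at hs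
    funext i
    refine hs b ?_ i
    have h1 : ∑ i, (⟨_, h i⟩ : O) * u i.1 = 0 := by
      apply Subtype.ext
      push_cast
      simp only [Algebra.smul_def] at ha
      simp only [mul_assoc, ← Finset.mul_sum, ha, mul_zero]
    have h2 := congrArg ρ h1
    simpa [hh, hu, Algebra.smul_def] using h2
  rw [LinearIndependent.iff_fractionRing R F] at key
  simpa using key.fintype_card_le_finrank

/-- Case `R = K[X]`, `X ↦ π` with `π` in the maximal ideal. -/
theorem aux_rank_le_K {K F E κ : Type*} [Field K] [Field F] [Algebra K[X] F]
    [IsFractionRing K[X] F] [Field E] [Algebra K E] [Algebra K[X] E] [Algebra F E]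
    [IsScalarTower K[X] F E] [IsScalarTower K K[X] E]
    [FiniteDimensional F E] [Field κ] [Algebra K κ]
    (O : ValuationSubring E) (ρ : O →+* κ) (hρ : Function.Surjective ρ)
    (hK : ∀ c : K, ∃ h : algebraMap K E c ∈ O, ρ ⟨_, h⟩ = algebraMap K κ c)
    (hX : ∃ h : algebraMap K[X] E X ∈ O, ρ ⟨_, h⟩ = 0) (hX0 : algebraMap K[X] E X ≠ 0) :
    Module.rank K κ ≤ (Module.finrank F E : ℕ) := by
  classical
  refine aux_rank_le_of_lift (R := K[X]) (F := F) O ρ hρ fun s a ha => ?_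
  have hex : ∃ m, ∃ i, (a i).coeff m ≠ 0 := by
    by_contra hcon
    push Not at hcon
    exact ha (funext fun i => Polynomial.ext fun m => by simpa using hcon m i)
  obtain ⟨i0, hi0⟩ := Nat.find_spec hex
  have hmin := fun n (hn : n < Nat.find hex) => Nat.find_min hex hn
  set m := Nat.find hex
  push Not at hmin
  have hdvd : ∀ i, X ^ m ∣ a i := fun i => X_pow_dvd_iff.2 fun d hd => hmin d hd i
  choose q hq using hdvd
  refine ⟨(algebraMap K[X] E X ^ m)⁻¹, fun i => (a i).coeff m,
    fun h => hi0 (congrFun h i0), fun i => ?_⟩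
  have e1 : (algebraMap K[X] E X ^ m)⁻¹ * algebraMap K[X] E (a i) = algebraMap K[X] E (q i) := by
    rw [hq i, map_mul, map_pow, inv_mul_cancel_left₀ (pow_ne_zero _ hX0)]
  have e2 : (a i).coeff m = (q i).coeff 0 := by
    rw [hq i]; simpa using coeff_X_pow_mul (q i) m 0
  beta_reduce
  rw [e2]
  have key : ∀ p : K[X], ∃ h : algebraMap K[X] E p ∈ O, ρ ⟨_, h⟩ = algebraMap K κ (p.coeff 0) := by
    intro p
    obtain ⟨hX1, hX2⟩ := hX
    induction p using Polynomial.induction_on' with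
    | add p q hp hq =>
      obtain ⟨h1, h2⟩ := hp
      obtain ⟨h3, h4⟩ := hq
      refine ⟨by rw [map_add]; exact add_mem h1 h3, ?_⟩
      have : (⟨algebraMap K[X] E (p + q), by rw [map_add]; exact add_mem h1 h3⟩ : O) =
        ⟨_, h1⟩ + ⟨_, h3⟩ := Subtype.ext (map_add _ _ _)
      rw [this, map_add, h2, h4]; simp
    | monomial n c =>
      obtain ⟨h1, h2⟩ := hK c
      have e3 : algebraMap K[X] E (monomial n c) = algebraMap K E c * algebraMap K[X] E X ^ n := by
        rw [← C_mul_X_pow_eq_monomial, map_mul, map_pow, IsScalarTower.algebraMap_apply K K[X] E,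
          Polynomial.algebraMap_eq]
      refine ⟨by rw [e3]; exact mul_mem h1 (pow_mem hX1 _), ?_⟩
      have : (⟨algebraMap K[X] E (monomial n c), by
          rw [e3]; exact mul_mem h1 (pow_mem hX1 _)⟩ : O) =
        ⟨_, h1⟩ * ⟨_, hX1⟩ ^ n := Subtype.ext e3
      rw [this, map_mul, map_pow, h2, hX2]
      rcases n with _ | n <;> simp [coeff_monomial]
  obtain ⟨h1, h2⟩ := key (q i)
  refine ⟨by rw [e1]; exact h1, ?_⟩
  rw [← h2]; congr 1; exact Subtype.ext e1

/-- Existence of the valuation ring. -/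
theorem aux_exists_val {K E : Type*} [Field K] [Field E] [Algebra K E] (π : E)
    (hπ : Transcendental K π) :
    ∃ O : ValuationSubring E, (∀ c : K, algebraMap K E c ∈ O) ∧ π ∈ O.nonunits := by
  let A : Subring E := (aeval (R := K) π).toRingHom.range
  let π' : A := ⟨π, X, by simp⟩
  have hI : Ideal.span {π'} ≠ ⊤ := by
    intro h
    rw [Ideal.span_singleton_eq_top, isUnit_iff_exists_inv] at h
    obtain ⟨⟨_, q, rfl⟩, hq⟩ := h
    have h1 : aeval (R := K) π (X * q - 1) = 0 := by
      have := congrArg Subtype.val hq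
      simp [π'] at this
      simp [this]
    have h2 := (transcendental_iff.1 hπ) _ h1
    have := congrArg (Polynomial.eval 0) h2
    simp at this
  obtain ⟨O, h1, h2⟩ := Ideal.image_subset_nonunits_valuationSubring _ hI
  exact ⟨O, fun c => h1 ⟨C c, by simp⟩, h2 ⟨π', Ideal.mem_span_singleton_self _, rfl⟩⟩

/-- Euclid style choice. -/
theorem aux_exists_N {k K : Type*} [Field k] [Field K] [Algebra k K] (d : K[X]) (hd : d ≠ 0) :
    ∃ N : k[X], N ≠ 0 ∧ ∀ p : k[X], IsCoprime p N → IsCoprime (p.map (algebraMap k K)) d := by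
  induction d using UniqueFactorizationMonoid.induction_on_prime with
  | h₁ => exact absurd rfl hd
  | h₂ u hu => exact ⟨1, one_ne_zero, fun p _ => by
      obtain ⟨u, rfl⟩ := hu
      exact ⟨0, (u⁻¹ : (K[X])ˣ), by simp⟩⟩
  | h₃ a q ha hq ih =>
    obtain ⟨N, hN, h⟩ := ih ha
    by_cases hM : ∃ M : k[X], M ≠ 0 ∧ q ∣ M.map (algebraMap k K)
    · obtain ⟨M, hM0, hqM⟩ := hM
      refine ⟨M * N, mul_ne_zero hM0 hN, fun p hp => ?_⟩
      rw [IsCoprime.mul_right_iff] at hp ⊢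
      refine ⟨?_, h p hp.2⟩
      exact IsCoprime.of_isCoprime_of_dvd_right (hp.1.map (mapRingHom (algebraMap k K))) hqM
    · push Not at hM
      refine ⟨X * N, mul_ne_zero X_ne_zero hN, fun p hp => ?_⟩
      rw [IsCoprime.mul_right_iff] at hp ⊢
      refine ⟨?_, h p hp.2⟩
      have hp0 : p ≠ 0 := by
        rintro rfl
        exact Polynomial.not_isUnit_X (isCoprime_zero_left.1 hp.1)
      exact ((Irreducible.coprime_iff_not_dvd hq.irreducible).2 (hM p hp0)).symm

theorem aux_exists_p {k K : Type*} [Field k] [Field K] [Algebra k K] (d : K[X]) (hd : d ≠ 0) :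
    ∃ p : k[X], 0 < p.natDegree ∧ IsCoprime (p.map (algebraMap k K)) d := by
  obtain ⟨N, hN, h⟩ := aux_exists_N (k := k) d hd
  refine ⟨1 + X * N, ?_, h _ ⟨1, -X, by ring⟩⟩
  rw [add_comm, ← C_1, natDegree_add_C, natDegree_X_mul hN]; omega

theorem aux_toSubring {k B : Type*} [Field k] [CommRing B] [Algebra k B] (T : Subalgebra k B) (p : B[X]) (h : ∀ n, p.coeff n ∈ T) :
    ∃ q : T[X], q.map T.val.toRingHom = p := by
  have : p ∈ Polynomial.lifts T.val.toRingHom := by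
    rw [Polynomial.lifts_iff_coeff_lifts]
    intro n; exact ⟨⟨_, h n⟩, rfl⟩
  exact this

/-- reduction of polynomials -/
theorem aux_reduce {k B E κB κ : Type*} [Field k] [Field B] [Field E] [Field κB] [Field κ]
    [Algebra k B] [Algebra k κB] [Algebra B E]
    [Algebra κB κ] (O : ValuationSubring E) (ρ : O →+* κ)
    (BO : Subalgebra k B) (hBO : ∀ b, b ∈ BO ↔ algebraMap B E b ∈ O) (r : BO →ₐ[k] κB)
    (hr : ∀ b : BO, algebraMap κB κ (r b) = ρ ⟨algebraMap B E b, (hBO b).1 b.2⟩)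
    (t : O) (q : BO[X]) :
    ∃ h : aeval (t : E) (q.map BO.val.toRingHom) ∈ O, ρ ⟨_, h⟩ = aeval (ρ t) (q.map r.toRingHom) := by
  let ι : BO →+* O := ((algebraMap B E).comp BO.val.toRingHom).codRestrict O.toSubring
    (fun b => (hBO b).1 b.2)
  have e1 : aeval (t : E) (q.map BO.val.toRingHom) = (eval₂ ι t q : O) := by
    rw [aeval_def, eval₂_map]
    change _ = O.subtype (eval₂ ι t q)
    rw [hom_eval₂]; rfl
  refine ⟨by rw [e1]; exact (eval₂ ι t q).2, ?_⟩
  have e2 : (⟨aeval (t : E) (q.map BO.val.toRingHom), by rw [e1]; exact (eval₂ ι t q).2⟩ : O) =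
    eval₂ ι t q := Subtype.ext e1
  rw [e2, hom_eval₂, aeval_def, eval₂_map]
  congr 1
  ext b; exact (hr b).symm

theorem aux_rank_le_B {k B F E κB κF κ : Type*} [Field k] [Field B] [Algebra k B] [Field F] [Algebra B[X] F]
    [IsFractionRing B[X] F] [Field E] [Algebra B E] [Algebra B[X] E] [Algebra F E]
    [IsScalarTower B[X] F E] [FiniteDimensional F E] [Field κB] [Field κ] [Field κF]
    [Algebra k κB] [Algebra κB κ] [Algebra κF κ] (O : ValuationSubring E) (ρ : O →+* κ)
    (hρ : Function.Surjective ρ)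
    (BO : Subalgebra k B) (hBO : ∀ b, b ∈ BO ↔ algebraMap B E b ∈ O) (r : BO →ₐ[k] κB)
    (hr : ∀ b : BO, algebraMap κB κ (r b) = ρ ⟨algebraMap B E b, (hBO b).1 b.2⟩)
    (t : O) (ht : ∀ p : B[X], algebraMap B[X] E p = aeval (t : E) p)
    (φ : κB[X] →+* κF) (hφ : Function.Injective φ)
    (hφ' : ∀ p, algebraMap κF κ (φ p) = aeval (ρ t) p) :
    Module.rank κF κ ≤ (Module.finrank F E : ℕ) := by
  classical
  refine aux_rank_le_of_lift (R := B[X]) (F := F) O ρ hρ fun s a ha => ?_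
  let J : Finset (s × ℕ) := Finset.univ.biUnion fun i => (a i).support.image fun n => (i, n)
  have hJ : ∀ i n, (i, n) ∈ J ↔ (a i).coeff n ≠ 0 := by
    intro i n; simp [J]
  have hJne : J.Nonempty := by
    by_contra hcon
    rw [Finset.not_nonempty_iff_eq_empty] at hcon
    refine ha (funext fun i => Polynomial.ext fun m => ?_)
    by_contra h
    have := (hJ i m).2 h
    rw [hcon] at this; simp at this
  obtain ⟨⟨i0, n0⟩, h0, hmax⟩ := Finset.exists_max_image J
    (fun x => O.valuation (algebraMap B E ((a x.1).coeff x.2))) hJne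
  have hc0 := (hJ _ _).1 h0
  set c0 := (a i0).coeff n0 with hc0'
  have hcE : algebraMap B E c0 ≠ 0 := by simpa using hc0
  have hmem : ∀ i n, (C c0⁻¹ * a i).coeff n ∈ BO := by
    intro i n
    rw [hBO, coeff_C_mul, ← ValuationSubring.valuation_le_one_iff, map_mul, map_mul, map_inv₀,
      map_inv₀]
    by_cases h : (a i).coeff n = 0
    · simp [h]
    have h1 := hmax (i, n) ((hJ i n).2 h)
    dsimp only at h1
    rw [inv_mul_le_iff₀ (by simpa [zero_lt_iff] using hc0), mul_one]
    exact h1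
  choose q hq using fun i => aux_toSubring BO _ (hmem i)
  refine ⟨algebraMap B E c0⁻¹, fun i => φ ((q i).map r.toRingHom), ?_, fun i => ?_⟩
  · intro h
    have h1 : (q i0).map r.toRingHom = 0 := hφ (by simpa using congrFun h i0)
    have h2 : (q i0).coeff n0 = 1 := by
      apply Subtype.ext
      have := congrArg (fun p => p.coeff n0) (hq i0)
      simp only [coeff_map, coeff_C_mul] at this
      rw [← hc0', inv_mul_cancel₀ hc0] at this
      exact this
    have := congrArg (fun p => p.coeff n0) h1
    simp [h2] at this
  · obtain ⟨h1, h2⟩ := aux_reduce O ρ BO hBO r hr t (q i)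
    have e : algebraMap B E c0⁻¹ * algebraMap B[X] E (a i) = aeval (t : E) ((q i).map BO.val.toRingHom) := by
      rw [hq, ht, map_mul, aeval_C]
    refine ⟨by rw [e]; exact h1, ?_⟩
    rw [hφ', ← h2]; congr 1; exact Subtype.ext e

theorem aux_trdeg_add {k L M : Type*} [Field k] [Field L] [Field M] [Algebra k L] [Algebra L M]
    [Algebra k M] [IsScalarTower k L M] {a b : ℕ} (h1 : Algebra.trdeg k L = a)
    (h2 : Algebra.trdeg L M = b) : Algebra.trdeg k M = (a + b : ℕ) := by
  have h := lift_trdeg_add_eq (R := k) (S := L) (A := M)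
  rw [h1, h2] at h
  simp only [Cardinal.lift_natCast, ← Nat.cast_add] at h
  have h' := h.symm
  exact Cardinal.lift_injective (h'.trans (Cardinal.lift_natCast _).symm)

theorem aux_trdeg_sub {k L M : Type*} [Field k] [Field L] [Field M] [Algebra k L] [Algebra L M]
    [Algebra k M] [IsScalarTower k L M] {a b : ℕ} (h1 : Algebra.trdeg k M = (a + b : ℕ))
    (h2 : Algebra.trdeg L M = b) : Algebra.trdeg k L = a := by
  have h := lift_trdeg_add_eq (R := k) (S := L) (A := M)
  rw [h1, h2] at h
  simp only [Cardinal.lift_natCast] at h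
  have hlt : Cardinal.lift (Algebra.trdeg k L) < Cardinal.aleph0 :=
    lt_of_le_of_lt (le_self_add.trans h.le) Cardinal.natCast_lt_aleph0
  obtain ⟨n, hn⟩ := Cardinal.lt_aleph0.1 hlt
  rw [hn] at h
  have h3 : n = a := by
    have : n + b = a + b := by exact_mod_cast h
    omega
  rw [h3] at hn
  exact Cardinal.lift_injective (hn.trans (Cardinal.lift_natCast _).symm)

/-- The contradiction step: the residue field of `B` cannot have the same transcendence degree. -/
theorem aux_trdeg_ne {k B κB : Type*} [Field k] [Field B] [Field κB] [Algebra k B] [Algebra k κB]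
    (BO : Subalgebra k B) (r : BO →ₐ[k] κB) (hr : Function.Surjective r) (π : BO) (hπ : π ≠ 0)
    (hπ' : r π = 0) {n : ℕ} (h1 : Algebra.trdeg k B = n) (h2 : Algebra.trdeg k κB = n) : False := by
  obtain ⟨s, hs⟩ := exists_isTranscendenceBasis k κB
  choose z hz using hr
  let y : s → BO := fun i => z i.1
  have hy : AlgebraicIndependent k y := by
    apply AlgebraicIndependent.of_comp r
    convert hs.1 using 1
    funext i; simp [y, hz]
  have hyB : AlgebraicIndependent k (BO.val ∘ y) := hy.map' Subtype.val_injective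
  have hcard := hs.cardinalMk_eq_trdeg
  rw [h2] at hcard
  have : Finite s := by
    rw [← Cardinal.lt_aleph0_iff_finite, hcard]; exact Cardinal.natCast_lt_aleph0
  have htb : IsTranscendenceBasis k (BO.val ∘ y) := by
    apply hyB.isTranscendenceBasis_of_lift_trdeg_le_of_finite
    rw [h1, hcard]; simp
  have := htb.isAlgebraic
  obtain ⟨f, hf0, hf⟩ := (Algebra.IsAlgebraic.isAlgebraic
    (R := Algebra.adjoin k (Set.range (BO.val ∘ y))) (π : B)).exists_nonzero_coeff_and_aeval_eq_zero
    (mem_nonZeroDivisors_of_ne_zero (by simpa using hπ))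
  have hle : Algebra.adjoin k (Set.range (BO.val ∘ y)) ≤ BO := by
    rw [Algebra.adjoin_le_iff]
    rintro _ ⟨i, rfl⟩; exact (y i).2
  have hg : aeval (π : B) f.divX ∈ BO := by
    rw [aeval_eq_sum_range]
    refine sum_mem fun i _ => ?_
    rw [Algebra.smul_def]
    exact mul_mem (hle (f.divX.coeff i).2) (pow_mem π.2 _)
  have h3 : aeval (π : B) f.divX * (π : B) + (f.coeff 0 : B) = 0 := by
    have := congrArg (aeval (π : B)) (divX_mul_X_add f)
    rw [map_add, map_mul, aeval_X, aeval_C, hf] at this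
    exact this
  obtain ⟨c, hc⟩ : ∃ c, c = f.coeff 0 := ⟨_, rfl⟩
  rw [← hc] at h3 hf0
  obtain ⟨c, hcm⟩ := c
  obtain ⟨p, hp⟩ : ∃ p, MvPolynomial.aeval (BO.val ∘ y) p = c := by
    rw [Algebra.adjoin_range_eq_range_aeval] at hcm
    exact hcm
  have hp' : (MvPolynomial.aeval y p : BO) = -(⟨_, hg⟩ * π) := by
    apply Subtype.ext
    have : ((MvPolynomial.aeval y p : BO) : B) = c := by
      rw [← hp]
      exact MvPolynomial.map_aeval y BO.val.toRingHom p |>.trans (by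
        rw [MvPolynomial.aeval_def]; rfl)
    rw [this]
    simp only [Subalgebra.coe_neg, Subalgebra.coe_mul]
    linear_combination h3
  have h4 : MvPolynomial.aeval (Subtype.val : s → κB) p = 0 := by
    have h5 := congrArg r hp'
    rw [map_neg, map_mul, hπ', mul_zero, neg_zero] at h5
    rw [← h5]
    have : r (MvPolynomial.aeval y p) = MvPolynomial.aeval (r ∘ y) p := by
      exact (MvPolynomial.comp_aeval_apply y r p)
    rw [this]
    congr 2
    funext i; simp [y, hz]
  have h6 : p = 0 := hs.1.eq_zero_of_aeval_eq_zero p h4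
  apply hf0
  apply Subtype.ext
  rw [h6, map_zero] at hp
  exact hp.symm

theorem aux_transc {k K B E κB κ : Type*} [Field k] [Field K] [Field B] [Field E] [Field κB]
    [Field κ] [Algebra k K] [Algebra k B] [Algebra k κB] [Algebra k κ] [Algebra K E] [Algebra B E]
    [Algebra K κ] [Algebra κB κ] [IsScalarTower k K κ] [IsScalarTower k κB κ]
    [Algebra.IsAlgebraic K κ]
    (O : ValuationSubring E) (ρ : O →+* κ)
    (hK : ∀ c : K, ∃ h : algebraMap K E c ∈ O, ρ ⟨_, h⟩ = algebraMap K κ c)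
    (BO : Subalgebra k B) (hBO : ∀ b, b ∈ BO ↔ algebraMap B E b ∈ O) (r : BO →ₐ[k] κB)
    (hr : ∀ b : BO, algebraMap κB κ (r b) = ρ ⟨algebraMap B E b, (hBO b).1 b.2⟩)
    (hrs : Function.Surjective r)
    (π : BO) (hπ : π ≠ 0) (hπ' : r π = 0) {n : ℕ}
    (h1 : Algebra.trdeg k B = n) (h2 : Algebra.trdeg k K = n)
    (t : O) (G : Set K) (hG : IntermediateField.adjoin k G = ⊤)
    (hQ : ∀ y ∈ G, ∃ Q : BO[X][X],
      eval₂ ((aeval (R := B) (t : E)).toRingHom.comp (mapRingHom BO.val.toRingHom))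
        (algebraMap K E y) Q = 0 ∧
      ∃ m, aeval (t : E) ((Q.coeff m).map BO.val.toRingHom) ≠ 0 ∧
        (aeval (t : E) ((Q.coeff m).map BO.val.toRingHom))⁻¹ ∈ O) :
    Transcendental κB (ρ t) := by
  intro htalg
  let L : IntermediateField κB κ := algebraicClosure κB κ
  have hLalg : Algebra.IsAlgebraic κB L := algebraicClosure.isAlgebraic κB κ
  let tL : L := ⟨ρ t, mem_algebraicClosure_iff.2 htalg⟩
  have hGL : ∀ y ∈ G, algebraMap K κ y ∈ L := by
    intro y hy
    obtain ⟨Q, hQ0, m, hm, hm'⟩ := hQ y hy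
    obtain ⟨hyO, hyρ⟩ := hK y
    let ψ : BO[X] →+* L := eval₂RingHom ((algebraMap κB L).comp r.toRingHom) tL
    let ι : BO →+* O := ((algebraMap B E).comp BO.val.toRingHom).codRestrict O.toSubring
      (fun b => (hBO b).1 b.2)
    let θ : BO[X] →+* O := eval₂RingHom ι t
    have eθ : O.subtype.comp θ =
        (aeval (R := B) (t : E)).toRingHom.comp (mapRingHom BO.val.toRingHom) := by
      ext b
      · simp [θ, ι]
      · simp [θ]
    have eψ : (algebraMap L κ).comp ψ = ρ.comp θ := by
      ext b
      · simp [θ, ψ]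
        exact hr b
      · simp [θ, ψ]; rfl
    have hθ0 : eval₂ θ ⟨_, hyO⟩ Q = 0 := by
      apply Subtype.ext
      change O.subtype (eval₂ θ ⟨_, hyO⟩ Q) = 0
      rw [hom_eval₂, eθ]; exact hQ0
    have hψ0 : aeval (algebraMap K κ y) (Q.map ψ) = 0 := by
      rw [aeval_def, eval₂_map, eψ, ← hyρ, ← hom_eval₂, hθ0, map_zero]
    have hne : Q.map ψ ≠ 0 := by
      intro h
      have h3 := congrArg (fun p => algebraMap L κ (p.coeff m)) h
      simp only [coeff_map, coeff_zero, map_zero] at h3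
      change ((algebraMap L κ).comp ψ) (Q.coeff m) = 0 at h3
      rw [eψ] at h3
      have e3 : (θ (Q.coeff m) : E) = aeval (t : E) ((Q.coeff m).map BO.val.toRingHom) :=
        RingHom.congr_fun eθ (Q.coeff m)
      rw [← e3] at hm hm'
      have : θ (Q.coeff m) * ⟨_, hm'⟩ = 1 := Subtype.ext (mul_inv_cancel₀ hm)
      have h5 := congrArg ρ this
      change ρ (θ (Q.coeff m)) = 0 at h3
      rw [map_mul, h3, zero_mul, map_one] at h5
      exact zero_ne_one h5
    have : IsAlgebraic L (algebraMap K κ y) := ⟨_, hne, hψ0⟩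
    exact mem_algebraicClosure_iff.2 (this.restrictScalars κB)
  have hKL : ∀ c : K, algebraMap K κ c ∈ L := by
    have : (⊤ : IntermediateField k K) ≤ (L.restrictScalars k).comap (Algebra.ofId K κ |>.restrictScalars k) := by
      rw [← hG, IntermediateField.adjoin_le_iff]
      exact hGL
    exact fun c => this (IntermediateField.mem_top)
  let i : K →+* L := (algebraMap K κ).codRestrict L.toSubring hKL
  let := i.toAlgebra
  have : IsScalarTower K L κ := IsScalarTower.of_algebraMap_eq fun _ => rfl
  have : Algebra.IsAlgebraic L κ := Algebra.IsAlgebraic.tower_top (K := K) L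
  have : Algebra.IsAlgebraic κB κ := Algebra.IsAlgebraic.trans κB L κ
  have h4 : Algebra.trdeg k κ = (n + 0 : ℕ) :=
    aux_trdeg_add h2 (by simp [trdeg_eq_zero])
  have h5 : Algebra.trdeg k κB = n :=
    aux_trdeg_sub h4 (by simp [trdeg_eq_zero])
  exact aux_trdeg_ne BO r hrs π hπ hπ' h1 h5

theorem aux_integral_mem {R E : Type*} [CommRing R] [Field E] [Algebra R E] (O : ValuationSubring E)
    (h : ∀ c : R, algebraMap R E c ∈ O) (z : E) (hz : IsIntegral R z) : z ∈ O := by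
  let φ : R →+* O := (algebraMap R E).codRestrict O.toSubring h
  let := φ.toAlgebra
  have : IsScalarTower R O E := IsScalarTower.of_algebraMap_eq fun _ => rfl
  have h1 : IsIntegral O z := hz.tower_top
  obtain ⟨y, hy⟩ := IsIntegrallyClosed.isIntegral_iff.1 h1
  rw [← hy]; exact y.2

theorem aux_exists_place (k : Type*) {K E : Type*} [Field k] [Field K] [Field E] [Algebra k K] [Algebra K E]
    [Algebra K[X] E] [IsScalarTower K K[X] E] [Algebra.IsAlgebraic K[X] E]
    [FaithfulSMul K[X] E] (S : Finset E) :
    ∃ p : k[X], 0 < p.natDegree ∧ ∃ O : ValuationSubring E, (∀ c : K, algebraMap K E c ∈ O) ∧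
      algebraMap K[X] E (p.map (algebraMap k K)) ∈ O.nonunits ∧ ∀ s ∈ S, s ∈ O := by
  classical
  have hinj := FaithfulSMul.algebraMap_injective K[X] E
  choose d hd0 hd using fun s : E => IsAlgebraic.exists_integral_multiple (R := K[X])
    (Algebra.IsAlgebraic.isAlgebraic s)
  obtain ⟨p, hp, hcop⟩ := aux_exists_p (k := k) (∏ s ∈ S, d s)
    (Finset.prod_ne_zero_iff.2 fun s _ => hd0 s)
  have hcop' := IsCoprime.prod_right_iff.1 hcop
  set P := p.map (algebraMap k K) with hP
  have hPdeg : 0 < P.natDegree := by rw [hP, natDegree_map]; exact hp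
  obtain ⟨O, hO, hπ⟩ := aux_exists_val (K := K) (algebraMap K[X] E P) (by
    have : Transcendental K P := Polynomial.transcendental P hPdeg.ne' (by
      rw [mem_nonZeroDivisors_iff_ne_zero, Ne, leadingCoeff_eq_zero]
      intro h; simp [h] at hPdeg)
    exact (transcendental_algebraMap_iff hinj).2 this)
  have hXO : algebraMap K[X] E X ∈ O := by
    let φ : K →+* O := (algebraMap K E).codRestrict O.toSubring hO
    have hπO : algebraMap K[X] E P ∈ O := O.nonunits_subset hπ
    let q : O[X] := P.map φ - C ⟨_, hπO⟩
    have hx : ∀ p : K[X], algebraMap K[X] E p = aeval (algebraMap K[X] E X) p := by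
      intro p
      rw [aeval_algebraMap_apply]; simp
    have hq : aeval (algebraMap K[X] E X) q = 0 := by
      simp only [q, map_sub, aeval_C]
      rw [aeval_def, eval₂_map]
      have : eval₂ ((algebraMap O E).comp φ) (algebraMap K[X] E X) P = algebraMap K[X] E P := by
        rw [hx P, aeval_def]; rfl
      rw [this]; simp
    have hlc : q.leadingCoeff = φ P.leadingCoeff := by
      rw [leadingCoeff_sub_of_degree_lt, leadingCoeff_map_of_injective φ.injective]
      refine lt_of_le_of_lt degree_C_le ?_
      rw [degree_map]; exact natDegree_pos_iff_degree_pos.1 hPdeg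
    have h3 := isIntegral_leadingCoeff_smul q _ hq
    obtain ⟨y, hy⟩ := IsIntegrallyClosed.isIntegral_iff.1 h3
    have h4 : φ P.leadingCoeff⁻¹ • (algebraMap O E y) = algebraMap K[X] E X := by
      rw [hy, hlc, smul_smul, ← map_mul, inv_mul_cancel₀, map_one, one_smul]
      intro h
      rw [leadingCoeff_eq_zero] at h
      simp [h] at hPdeg
    rw [← h4, Algebra.smul_def, ← map_mul]
    exact (φ P.leadingCoeff⁻¹ * y).2
  have hall : ∀ c : K[X], algebraMap K[X] E c ∈ O := by
    intro c
    induction c using Polynomial.induction_on' with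
    | add p q hp hq => rw [map_add]; exact add_mem hp hq
    | monomial n c =>
      rw [← C_mul_X_pow_eq_monomial, map_mul, map_pow]
      refine mul_mem ?_ (pow_mem hXO n)
      rw [← Polynomial.algebraMap_eq, ← IsScalarTower.algebraMap_apply K K[X] E]
      exact hO c
  refine ⟨p, hp, O, hO, hπ, fun s hs => ?_⟩
  have h5 : algebraMap K[X] E (d s) * s ∈ O := by
    have := aux_integral_mem O hall _ (hd s)
    rwa [Algebra.smul_def] at this
  have h6 : (algebraMap K[X] E (d s))⁻¹ ∈ O := by
    rw [← ValuationSubring.valuation_le_one_iff, map_inv₀]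
    by_contra hlt
    rw [not_le, one_lt_inv₀ (by simpa [zero_lt_iff] using hd0 s)] at hlt
    obtain ⟨u, v, huv⟩ := hcop' s hs
    have h7 := congrArg (fun c => O.valuation (algebraMap K[X] E c)) huv
    simp only [map_add, map_mul, map_one] at h7
    rw [ValuationSubring.mem_nonunits_iff] at hπ
    have hle : ∀ c, O.valuation (algebraMap K[X] E c) ≤ 1 := fun c =>
      (ValuationSubring.valuation_le_one_iff _ _).2 (hall c)
    have h8 := O.valuation.map_add_lt (x := algebraMap K[X] E u * algebraMap K[X] E P)
      (y := algebraMap K[X] E v * algebraMap K[X] E (d s)) (g := 1)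
      (by rw [map_mul]; exact lt_of_le_of_lt (mul_le_of_le_one_left' (hle u)) hπ)
      (by rw [map_mul]; exact lt_of_le_of_lt (mul_le_of_le_one_left' (hle v)) hlt)
    rw [← map_mul, ← map_mul, ← map_add, huv] at h8
    simp at h8
  have : s = (algebraMap K[X] E (d s))⁻¹ * (algebraMap K[X] E (d s) * s) := by
    rw [inv_mul_cancel_left₀]
    simpa using hd0 s
  rw [this]
  exact mul_mem h6 h5

theorem aux_fg {k : Type*} {κB κ : Type*} [Field k] [Field κB] [Field κ] [Algebra k κB]
    [Algebra k κ] [Algebra κB κ] [IsScalarTower k κB κ] [Algebra.EssFiniteType k κ]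
    (t : κ) (ht : Transcendental κB t) [Algebra κB[X] κ]
    (htX : ∀ p : κB[X], algebraMap κB[X] κ p = aeval t p)
    [Algebra.IsAlgebraic κB[X] κ] : Algebra.EssFiniteType k κB := by
  classical
  have hfin : FinTrdeg k κB := by
    rw [finTrdeg_iff_trdeg, ← Cardinal.lift_lt_aleph0]
    refine lt_of_le_of_lt (lift_trdeg_le_of_injective (IsScalarTower.toAlgHom k κB κ)
      (algebraMap κB κ).injective) ?_
    rw [Cardinal.lift_lt_aleph0]
    exact trdeg_lt_aleph0 k κ
  obtain ⟨L, hL, hLalg⟩ := hfin.exists_fg_isAlgebraic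
  have hLess : Algebra.EssFiniteType k L := IntermediateField.essFiniteType_iff.2 hL
  have : IsScalarTower k L κ := IsScalarTower.of_algebraMap_eq fun c => by
    rw [IsScalarTower.algebraMap_apply k κB κ]; rfl
  have htL : Transcendental L t := by
    intro h; exact ht (h.extendScalars (S := κB) (algebraMap L κB).injective)
  let : Algebra L[X] κ := (aeval (R := L) t).toRingHom.toAlgebra
  have hmap : ∀ p : L[X], algebraMap L[X] κ p = aeval t p := fun _ => rfl
  have : IsScalarTower L L[X] κ := IsScalarTower.of_algebraMap_eq fun c => by
    rw [hmap, algebraMap_eq, aeval_C]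
  have : IsScalarTower k L[X] κ := IsScalarTower.of_algebraMap_eq fun c => by
    rw [hmap, IsScalarTower.algebraMap_apply k L L[X], algebraMap_eq, aeval_C,
      ← IsScalarTower.algebraMap_apply]
  have : FaithfulSMul L[X] κ := (faithfulSMul_iff_algebraMap_injective _ _).2
    ((transcendental_iff_injective).1 htL)
  let F := FractionRing L[X]
  let : Algebra F κ := FractionRing.liftAlgebra L[X] κ
  have : IsScalarTower L[X] F κ := FractionRing.isScalarTower_liftAlgebra L[X] κ
  have : IsScalarTower k F κ := IsScalarTower.of_algebraMap_eq fun c => by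
    rw [IsScalarTower.algebraMap_apply k L[X] F, ← IsScalarTower.algebraMap_apply L[X] F κ,
      ← IsScalarTower.algebraMap_apply]
  have : IsScalarTower L F κ := IsScalarTower.of_algebraMap_eq fun c => by
    rw [IsScalarTower.algebraMap_apply L L[X] F, ← IsScalarTower.algebraMap_apply L[X] F κ,
      ← IsScalarTower.algebraMap_apply]
  have : Algebra.EssFiniteType F κ := Algebra.EssFiniteType.of_comp k F κ
  let Z := algebraicClosure F κ
  have hZ : Algebra.IsAlgebraic F Z := algebraicClosure.isAlgebraic F κ
  have hBZ : ∀ b : κB, algebraMap κB κ b ∈ Z := by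
    intro b
    rw [mem_algebraicClosure_iff]
    have h1 : IsAlgebraic L b := Algebra.IsAlgebraic.isAlgebraic b
    have h2 : IsAlgebraic L (algebraMap κB κ b) := h1.algebraMap
    exact h2.extendScalars (algebraMap L F).injective
  have htZ : t ∈ Z := by
    have : t = algebraMap F κ (algebraMap L[X] F X) := by
      rw [← IsScalarTower.algebraMap_apply, hmap, aeval_X]
    rw [this]; exact Z.algebraMap_mem _
  have hBXZ : ∀ p : κB[X], algebraMap κB[X] κ p ∈ Z := by
    intro p
    rw [htX, aeval_eq_sum_range]
    refine sum_mem fun i _ => ?_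
    rw [Algebra.smul_def]
    exact mul_mem (hBZ _) (pow_mem htZ _)
  let i : κB[X] →+* Z := (algebraMap κB[X] κ).codRestrict Z.toSubring hBXZ
  let := i.toAlgebra
  have : IsScalarTower κB[X] Z κ := IsScalarTower.of_algebraMap_eq fun _ => rfl
  have hinj : Function.Injective (algebraMap κB[X] κ) := by
    intro p q h
    rw [htX, htX] at h
    exact (transcendental_iff_injective.1 ht) h
  have hinj' : Function.Injective (algebraMap κB[X] Z) := by
    intro p q h
    exact hinj (congrArg (algebraMap Z κ) h)
  have : Algebra.IsAlgebraic Z κ := ⟨fun z =>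
    (Algebra.IsAlgebraic.isAlgebraic (R := κB[X]) z).extendScalars hinj'⟩
  have : Algebra.IsAlgebraic F κ := Algebra.IsAlgebraic.trans F Z κ
  have : Module.Finite F κ := Algebra.finite_of_essFiniteType_of_isAlgebraic
  have hrank : Module.rank L κB ≤ (Module.finrank F κ : ℕ) := by
    refine rank_le fun s hs => ?_
    have key : LinearIndependent L[X] (fun i : s => algebraMap κB κ i.1) := by
      rw [Fintype.linearIndependent_iff]
      intro a ha
      have h0 : (∑ i, C i.1 * (a i).map (algebraMap L κB) : κB[X]) = 0 := by
        apply transcendental_iff_injective.1 ht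
        rw [map_zero, ← ha, map_sum]
        refine Finset.sum_congr rfl fun i _ => ?_
        rw [map_mul, aeval_C, aeval_map_algebraMap, Algebra.smul_def, hmap, mul_comm]
      rw [Fintype.linearIndependent_iff] at hs
      intro i
      ext1 n
      refine hs (fun i => (a i).coeff n) ?_ i
      have := congrArg (fun p => p.coeff n) h0
      simp only [finset_sum_coeff, coeff_C_mul, coeff_map, coeff_zero] at this
      simpa [Algebra.smul_def, mul_comm] using this
    rw [LinearIndependent.iff_fractionRing L[X] F] at key
    simpa using key.fintype_card_le_finrank
  have : Module.Finite L κB := by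
    rw [← Module.rank_lt_aleph0_iff]
    exact lt_of_le_of_lt hrank Cardinal.natCast_lt_aleph0
  exact Algebra.EssFiniteType.comp k L κB

theorem aux_trdeg_one {K E : Type*} [Field K] [Field E] [Algebra K E] [Algebra K[X] E]
    [IsScalarTower K K[X] E] [FaithfulSMul K[X] E] [Algebra.IsAlgebraic K[X] E] :
    Algebra.trdeg K E = (1 : ℕ) := by
  have h := lift_trdeg_add_eq K K[X] E
  rw [Polynomial.trdeg_of_isDomain, trdeg_eq_zero (R := K[X])] at h
  simp only [Cardinal.lift_one, Cardinal.lift_zero, add_zero] at h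
  rw [Nat.cast_one]
  exact Cardinal.lift_injective (h.symm.trans (Cardinal.lift_one).symm)

theorem aux_main_abs {k : Type u} {K : Type v} {B E κ : Type (max u v)} {F : Type*}
    [Field k] [Field K] [Field B] [Field E] [Field κ] [Field F]
    [Algebra k K] [Algebra k B] [Algebra k E] [Algebra k κ] [Algebra K E] [Algebra B E]
    [Algebra K κ] [IsScalarTower k K κ] [IsScalarTower k K E] [IsScalarTower k B E]
    [Algebra.EssFiniteType k K] [Module.Finite K κ]
    [Algebra B[X] F] [IsFractionRing B[X] F] [Algebra B[X] E] [Algebra F E]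
    [IsScalarTower B[X] F E] [FiniteDimensional F E]
    (O : ValuationSubring E) (ρ : O →+* κ) (hρ : Function.Surjective ρ) [IsLocalHom ρ]
    (hK : ∀ c : K, ∃ h : algebraMap K E c ∈ O, ρ ⟨_, h⟩ = algebraMap K κ c)
    (b0 : B) (hb0 : b0 ≠ 0) (hb0O : algebraMap B E b0 ∈ O) (hb0ρ : ρ ⟨_, hb0O⟩ = 0)
    {n : ℕ} (h1 : Algebra.trdeg k B = n) (h2 : Algebra.trdeg k K = n)
    (t : O) (htX : ∀ p : B[X], algebraMap B[X] E p = aeval (t : E) p)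
    (G : Set K) (hG : IntermediateField.adjoin k G = ⊤)
    (hQ : ∀ y ∈ G, ∃ Q : B[X][X], eval₂ (algebraMap B[X] E) (algebraMap K E y) Q = 0 ∧
      (∀ i j, algebraMap B E ((Q.coeff i).coeff j) ∈ O) ∧
      ∃ m, algebraMap B[X] E (Q.coeff m) ≠ 0 ∧ (algebraMap B[X] E (Q.coeff m))⁻¹ ∈ O) :
    ∃ e', 0 < e' ∧ e' ≤ Module.finrank F E ∧ HasCvgDiagram k K e' := by
  classical
  let BO : Subalgebra k B :=
    { (O.toSubring.comap (algebraMap B E)) with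
      algebraMap_mem' := fun c => by
        obtain ⟨h, _⟩ := hK (algebraMap k K c)
        change algebraMap B E (algebraMap k B c) ∈ O
        rw [← IsScalarTower.algebraMap_apply, IsScalarTower.algebraMap_apply k K E]
        exact h }
  have hBO : ∀ b, b ∈ BO ↔ algebraMap B E b ∈ O := fun b => Iff.rfl
  let ι : BO →+* O := ((algebraMap B E).comp BO.val.toRingHom).codRestrict O.toSubring
      (fun b => (hBO b).1 b.2)
  let r0 : BO →ₐ[k] κ :=
    { ρ.comp ι with
      commutes' := fun c => by
        obtain ⟨h, h'⟩ := hK (algebraMap k K c)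
        rw [IsScalarTower.algebraMap_apply k K κ, ← h']
        change ρ _ = ρ _
        congr 1
        apply Subtype.ext
        change algebraMap B E (algebraMap k B c) = algebraMap K E (algebraMap k K c)
        rw [← IsScalarTower.algebraMap_apply, IsScalarTower.algebraMap_apply k K E] }
  let κB : IntermediateField k κ := r0.range.toIntermediateField (by
    rintro _ ⟨b, rfl⟩
    by_cases hb : r0 b = 0
    · exact ⟨0, by change r0 0 = (r0 b)⁻¹; rw [hb, map_zero, inv_zero]⟩
    have hu : IsUnit (ι b) := by
      apply isUnit_of_map_unit ρ
      exact (isUnit_iff_ne_zero).2 hb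
    obtain ⟨c, hc⟩ := isUnit_iff_exists_inv.1 hu
    have hc' : algebraMap B E b * (c : E) = 1 := congrArg Subtype.val hc
    have hmem : (b : B)⁻¹ ∈ BO := by
      rw [hBO, map_inv₀, ← eq_inv_of_mul_eq_one_right hc']; exact c.2
    have hb0 : (b : B) ≠ 0 := by
      intro h; rw [h, map_zero, zero_mul] at hc'; exact zero_ne_one hc'
    refine ⟨⟨_, hmem⟩, ?_⟩
    change r0 ⟨_, hmem⟩ = (r0 b)⁻¹
    refine eq_inv_of_mul_eq_one_right ?_
    rw [← map_mul, ← map_one r0]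
    congr 1
    exact Subtype.ext (mul_inv_cancel₀ hb0))
  let r : BO →ₐ[k] κB := r0.codRestrict κB.toSubalgebra (fun b => ⟨b, rfl⟩)
  have hrs : Function.Surjective r := by
    rintro ⟨_, b, rfl⟩; exact ⟨b, rfl⟩
  have hr : ∀ b : BO, algebraMap κB κ (r b) = ρ ⟨algebraMap B E b, (hBO b).1 b.2⟩ := fun b => rfl
  let π : BO := ⟨b0, hb0O⟩
  have hπ : π ≠ 0 := fun h => hb0 (congrArg Subtype.val h)
  have hπ' : r π = 0 := Subtype.ext hb0ρ
  have htr : Transcendental κB (ρ t) := by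
    refine aux_transc O ρ hK BO hBO r hr hrs π hπ hπ' h1 h2 t G hG fun y hy => ?_
    obtain ⟨Q, hQ0, hQc, m, hm0, hm⟩ := hQ y hy
    choose q hq using fun i => aux_toSubring BO (Q.coeff i) (fun j => (hBO _).2 (hQc i j))
    have hlift : Q ∈ Polynomial.lifts (mapRingHom BO.val.toRingHom) := by
      rw [Polynomial.lifts_iff_coeff_lifts]
      intro i; exact ⟨q i, hq i⟩
    obtain ⟨Q', hQ'⟩ := hlift
    rw [coe_mapRingHom] at hQ'
    have hco : ∀ i, (Q'.coeff i).map BO.val.toRingHom = Q.coeff i := by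
      intro i; rw [← hQ', coeff_map]; rfl
    have hal : (aeval (R := B) (t : E)).toRingHom = algebraMap B[X] E :=
      RingHom.ext fun p => (htX p).symm
    refine ⟨Q', ?_, m, ?_, ?_⟩
    · rw [← eval₂_map, hal, hQ', hQ0]
    · rw [hco, ← htX]; exact hm0
    · rw [hco, ← htX]; exact hm
  have hinj := transcendental_iff_injective.1 htr
  let ψ : RatFunc κB →ₐ[k] κ := RatFunc.liftAlgHom ((aeval (R := κB) (ρ t)).restrictScalars k)
    (nonZeroDivisors_le_comap_nonZeroDivisors_of_injective _ hinj)
  have hψ : ∀ p : κB[X], ψ (algebraMap κB[X] (RatFunc κB) p) = aeval (ρ t) p := by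
    intro p
    simp [ψ, RatFunc.liftAlgHom_apply]
  let : Algebra (RatFunc κB) κ := ψ.toRingHom.toAlgebra
  have hrank : Module.rank (RatFunc κB) κ ≤ (Module.finrank F E : ℕ) :=
    aux_rank_le_B (B := B) (κB := κB) O ρ hρ BO hBO r hr t htX (algebraMap κB[X] (RatFunc κB))
      (IsFractionRing.injective _ _) hψ
  have hfin : Module.Finite (RatFunc κB) κ := by
    rw [← Module.rank_lt_aleph0_iff]
    exact lt_of_le_of_lt hrank Cardinal.natCast_lt_aleph0
  have hess : Algebra.EssFiniteType k κ := Algebra.EssFiniteType.comp k K κ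
  let : Algebra κB[X] κ := (aeval (R := κB) (ρ t)).toRingHom.toAlgebra
  have : IsScalarTower κB[X] (RatFunc κB) κ := IsScalarTower.of_algebraMap_eq fun p => (hψ p).symm
  have : Algebra.IsAlgebraic κB[X] κ :=
    (IsFractionRing.comap_isAlgebraic_iff (A := κB[X]) (K := RatFunc κB) (C := κ)).2 inferInstance
  have hessB : Algebra.EssFiniteType k κB := aux_fg (ρ t) htr (fun _ => rfl)
  refine ⟨Module.finrank (RatFunc κB) κ, Module.finrank_pos, ?_, κB, κ, inferInstance,
    inferInstance, inferInstance, inferInstance, IntermediateField.fg_top_iff.2 hessB,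
    IntermediateField.fg_top_iff.2 hess, IsScalarTower.toAlgHom k K κ, ψ, ?_, rfl⟩
  · rw [← Module.finrank_eq_rank] at hrank
    exact_mod_cast hrank
  · change (algebraMap K κ).Finite
    exact RingHom.finite_algebraMap.2 inferInstance

theorem aux_fin_K {K E κ : Type*} [Field K] [Field E] [Field κ] [Algebra K E] [Algebra K κ]
    [Algebra.EssFiniteType K E] (htr : Algebra.trdeg K E = (1 : ℕ)) (π : E)
    (hπt : Transcendental K π) (O : ValuationSubring E) (ρ : O →+* κ)
    (hρ : Function.Surjective ρ)
    (hK : ∀ c : K, ∃ h : algebraMap K E c ∈ O, ρ ⟨_, h⟩ = algebraMap K κ c)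
    (hπ : ∃ h : π ∈ O, ρ ⟨_, h⟩ = 0) : Module.Finite K κ := by
  let : Algebra K[X] E := (aeval (R := K) π).toRingHom.toAlgebra
  have hmap : ∀ p : K[X], algebraMap K[X] E p = aeval π p := fun _ => rfl
  have : IsScalarTower K K[X] E := IsScalarTower.of_algebraMap_eq fun c => by
    rw [hmap, algebraMap_eq, aeval_C]
  have : FaithfulSMul K[X] E := (faithfulSMul_iff_algebraMap_injective _ _).2
    ((transcendental_iff_injective).1 hπt)
  have halg : Algebra.IsAlgebraic K[X] E := by
    rw [← trdeg_eq_zero_iff]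
    have h := lift_trdeg_add_eq K K[X] E
    rw [Polynomial.trdeg_of_isDomain, htr] at h
    simp only [Cardinal.lift_one, Nat.cast_one] at h
    have hlt : Cardinal.lift (Algebra.trdeg K[X] E) < Cardinal.aleph0 :=
      lt_of_le_of_lt (le_add_self.trans h.le) Cardinal.one_lt_aleph0
    obtain ⟨n, hn⟩ := Cardinal.lt_aleph0.1 hlt
    rw [hn] at h
    have h3 : n = 0 := by
      have : 1 + n = 1 := by exact_mod_cast h
      omega
    rw [h3, Nat.cast_zero] at hn
    exact Cardinal.lift_injective (hn.trans (Cardinal.lift_zero).symm)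
  let F := FractionRing K[X]
  let : Algebra F E := FractionRing.liftAlgebra K[X] E
  have : IsScalarTower K[X] F E := FractionRing.isScalarTower_liftAlgebra K[X] E
  have : IsScalarTower K F E := IsScalarTower.of_algebraMap_eq fun c => by
    rw [IsScalarTower.algebraMap_apply K K[X] F, ← IsScalarTower.algebraMap_apply K[X] F E,
      ← IsScalarTower.algebraMap_apply]
  have : Algebra.EssFiniteType F E := Algebra.EssFiniteType.of_comp K F E
  have : Algebra.IsAlgebraic F E :=
    (IsFractionRing.comap_isAlgebraic_iff (A := K[X]) (K := F) (C := E)).1 halg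
  have : Module.Finite F E := Algebra.finite_of_essFiniteType_of_isAlgebraic
  have hX : algebraMap K[X] E X = π := by rw [hmap, aeval_X]
  have h1 : Module.rank K κ ≤ (Module.finrank F E : ℕ) := by
    refine aux_rank_le_K O ρ hρ hK ?_ ?_
    · rw [hX]; exact hπ
    · rw [hX]
      rintro rfl
      exact hπt isAlgebraic_zero
  rw [← Module.rank_lt_aleph0_iff]
  exact lt_of_le_of_lt h1 Cardinal.natCast_lt_aleph0

theorem aux_main {k : Type u} {K : Type v} {B E : Type (max u v)} {F : Type*}
    [Field k] [Field K] [Field B] [Field E] [Field F]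
    [Algebra k K] [Algebra k B] [Algebra k E] [Algebra K E] [Algebra B E]
    [IsScalarTower k K E] [IsScalarTower k B E]
    [Algebra.EssFiniteType k K] [Algebra.EssFiniteType K E]
    [Algebra K[X] E] [IsScalarTower K K[X] E] [FaithfulSMul K[X] E] [Algebra.IsAlgebraic K[X] E]
    [Algebra B[X] F] [IsFractionRing B[X] F] [Algebra B[X] E] [Algebra F E]
    [IsScalarTower B[X] F E] [FiniteDimensional F E]
    (hxB : ∀ p : k[X], ∃ b : B, algebraMap B E b = algebraMap K[X] E (p.map (algebraMap k K)))
    (t : E) (htX : ∀ p : B[X], algebraMap B[X] E p = aeval (t : E) p) :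
    ∃ e', 0 < e' ∧ e' ≤ Module.finrank F E ∧ HasCvgDiagram k K e' := by
  classical
  have hinjK := FaithfulSMul.algebraMap_injective K[X] E
  have : IsScalarTower B B[X] E := IsScalarTower.of_algebraMap_eq fun c => by
    rw [htX, algebraMap_eq, aeval_C]
  have : FaithfulSMul B[X] E := (faithfulSMul_iff_algebraMap_injective _ _).2 (by
    rw [IsScalarTower.algebraMap_eq B[X] F E]
    exact (algebraMap F E).injective.comp (IsFractionRing.injective B[X] F))
  have halgB : Algebra.IsAlgebraic B[X] E :=
    (IsFractionRing.comap_isAlgebraic_iff (A := B[X]) (K := F) (C := E)).2 inferInstance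
  have tK : Algebra.trdeg K E = (1 : ℕ) := aux_trdeg_one
  have tB : Algebra.trdeg B E = (1 : ℕ) := aux_trdeg_one
  obtain ⟨n, hn⟩ := Cardinal.lt_aleph0.1 (trdeg_lt_aleph0 k K)
  have hE : Algebra.trdeg k E = (n + 1 : ℕ) := aux_trdeg_add hn tK
  have hB : Algebra.trdeg k B = n := aux_trdeg_sub hE tB
  obtain ⟨G, hG⟩ := (IntermediateField.fg_top_iff (F := k) (E := K)).2 inferInstance
  choose Q hQ0 hQ using fun y : K =>
    Algebra.IsAlgebraic.isAlgebraic (R := B[X]) (algebraMap K E y)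
  let S : Finset E := insert t ((G.biUnion fun y => (Q y).support.biUnion fun i =>
    ((Q y).coeff i).support.image fun j => algebraMap B E (((Q y).coeff i).coeff j)) ∪
    G.image fun y => (algebraMap B[X] E (Q y).leadingCoeff)⁻¹)
  obtain ⟨p, hp, O, hO, hπ, hS⟩ := aux_exists_place k (K := K) S
  have htO : t ∈ O := hS t (by simp [S])
  set P := p.map (algebraMap k K) with hP
  have hPdeg : 0 < P.natDegree := by rw [hP, natDegree_map]; exact hp
  have hPt : Transcendental K (algebraMap K[X] E P) := by
    have : Transcendental K P := Polynomial.transcendental P hPdeg.ne' (by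
      rw [mem_nonZeroDivisors_iff_ne_zero, Ne, leadingCoeff_eq_zero]
      intro h; simp [h] at hPdeg)
    exact (transcendental_algebraMap_iff hinjK).2 this
  obtain ⟨b0, hb0⟩ := hxB p
  let κ := IsLocalRing.ResidueField O
  let ρ : O →+* κ := IsLocalRing.residue O
  let j : K →+* O := (algebraMap K E).codRestrict O.toSubring hO
  let : Algebra K κ := (ρ.comp j).toAlgebra
  let : Algebra k κ := ((ρ.comp j).comp (algebraMap k K)).toAlgebra
  have : IsScalarTower k K κ := IsScalarTower.of_algebraMap_eq fun _ => rfl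
  have hK : ∀ c : K, ∃ h : algebraMap K E c ∈ O, ρ ⟨_, h⟩ = algebraMap K κ c :=
    fun c => ⟨hO c, rfl⟩
  have hπO : algebraMap K[X] E P ∈ O := O.nonunits_subset hπ
  have hπρ : ρ ⟨_, hπO⟩ = 0 := by
    change IsLocalRing.residue O _ = 0
    rw [IsLocalRing.residue_eq_zero_iff]
    exact (ValuationSubring.coe_mem_nonunits_iff (a := ⟨_, hπO⟩)).1 hπ
  have hρ : Function.Surjective ρ := IsLocalRing.residue_surjective
  have : Module.Finite K κ := aux_fin_K tK _ hPt O ρ hρ hK ⟨hπO, hπρ⟩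
  have hb0ne : b0 ≠ 0 := by
    rintro rfl
    rw [map_zero] at hb0
    rw [← hb0] at hPt
    exact hPt isAlgebraic_zero
  have hb0O : algebraMap B E b0 ∈ O := by rw [hb0]; exact hπO
  have hb0ρ : ρ ⟨_, hb0O⟩ = 0 := by
    rw [← hπρ]; congr 1; exact Subtype.ext hb0
  have : IsLocalHom ρ := inferInstanceAs (IsLocalHom (IsLocalRing.residue O))
  refine aux_main_abs (F := F) O ρ hρ hK b0 hb0ne hb0O hb0ρ hB hn ⟨t, htO⟩ htX (G : Set K) hG
    fun y hy => ⟨Q y, hQ y, fun i j => ?_, (Q y).natDegree, ?_, ?_⟩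
  · by_cases h : ((Q y).coeff i).coeff j = 0
    · rw [h, map_zero]; exact zero_mem O
    apply hS
    simp only [S, Finset.mem_insert, Finset.mem_union]
    refine Or.inr (Or.inl ?_)
    refine Finset.mem_biUnion.2 ⟨y, hy, Finset.mem_biUnion.2 ⟨i, ?_, Finset.mem_image.2 ⟨j, ?_, rfl⟩⟩⟩
    · rw [mem_support_iff]; rintro h'; rw [h', coeff_zero] at h; exact h rfl
    · rw [mem_support_iff]; exact h
  · rw [coeff_natDegree]
    have := FaithfulSMul.algebraMap_injective B[X] E
    rw [Ne, map_eq_zero_iff _ this, leadingCoeff_eq_zero]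
    exact hQ0 y
  · apply hS
    simp only [S, Finset.mem_insert, Finset.mem_union]
    exact Or.inr (Or.inr (Finset.mem_image.2 ⟨y, hy, rfl⟩))


theorem aux_ratFunc_algebraMap (k : Type u) (K : Type v) [Field k] [Field K] [Algebra k K]
    (p : k[X]) : algebraMap (RatFunc k) (RatFunc K) (algebraMap k[X] (RatFunc k) p) =
      algebraMap K[X] (RatFunc K) (p.map (algebraMap k K)) := by
  change RatFunc.mapRingHom _ _ _ = _
  rw [RatFunc.coe_mapRingHom_eq_coe_map]
  have := RatFunc.map_apply_div (Polynomial.mapRingHom (algebraMap k K))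
    (polyMap_nonZeroDivisors_le k K) p 1
  simpa using this

theorem aux_ratFunc_const (A : Type u) (B : Type v) [Field A] [Field B] [Algebra A B]
    (z : A) : algebraMap A (RatFunc B) z = algebraMap B[X] (RatFunc B) (C (algebraMap A B z)) := by
  rw [IsScalarTower.algebraMap_apply A B[X] (RatFunc B)]
  rfl

theorem aux_dir2 {k : Type u} {K : Type v} [Field k] [Field K] [Algebra k K]
    (hK : Algebra.EssFiniteType k K) (e : ℕ) (he : 0 < e)
    (h : HasCvgDiagram (RatFunc k) (RatFunc K) e) :
    ∃ e', 0 < e' ∧ e' ≤ e ∧ HasCvgDiagram k K e' := by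
  obtain ⟨B, E, _, _, _, _, hB, hE, f, π, hf, hπ⟩ := h
  let : Algebra (RatFunc B) E := π.toRingHom.toAlgebra
  change Module.finrank (RatFunc B) E = e at hπ
  let : Algebra (RatFunc K) E := f.toRingHom.toAlgebra
  have hfin : Module.Finite (RatFunc K) E := hf
  let : Algebra K[X] E := (f.toRingHom.comp (algebraMap K[X] (RatFunc K))).toAlgebra
  have : IsScalarTower K[X] (RatFunc K) E := IsScalarTower.of_algebraMap_eq fun _ => rfl
  let : Algebra K E := ((algebraMap K[X] E).comp C).toAlgebra
  have : IsScalarTower K K[X] E := IsScalarTower.of_algebraMap_eq fun _ => rfl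
  let : Algebra B[X] E := (π.toRingHom.comp (algebraMap B[X] (RatFunc B))).toAlgebra
  have : IsScalarTower B[X] (RatFunc B) E := IsScalarTower.of_algebraMap_eq fun _ => rfl
  let : Algebra B E := ((algebraMap B[X] E).comp C).toAlgebra
  have hBE : ∀ z : RatFunc k, algebraMap B E (algebraMap (RatFunc k) B z) =
      algebraMap (RatFunc k) E z := by
    intro z
    rw [← π.commutes z]
    change π _ = π _
    congr 1
  have hKE : ∀ p : k[X], algebraMap (RatFunc k) E (algebraMap k[X] (RatFunc k) p) =
      algebraMap K[X] E (p.map (algebraMap k K)) := by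
    intro p
    rw [← f.commutes, aux_ratFunc_algebraMap]; rfl
  let : Algebra k B := ((algebraMap (RatFunc k) B).comp (algebraMap k (RatFunc k))).toAlgebra
  let : Algebra k E := ((algebraMap (RatFunc k) E).comp (algebraMap k (RatFunc k))).toAlgebra
  have : IsScalarTower k B E := IsScalarTower.of_algebraMap_eq fun c => (hBE _).symm
  have : IsScalarTower k K E := IsScalarTower.of_algebraMap_eq fun c => by
    change algebraMap (RatFunc k) E (algebraMap k (RatFunc k) c) =
      algebraMap K[X] E (C (algebraMap k K c))
    rw [← map_C, ← hKE, IsScalarTower.algebraMap_apply k k[X] (RatFunc k)]; rfl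
  have : Algebra.EssFiniteType K[X] (RatFunc K) :=
    Algebra.EssFiniteType.of_isLocalization _ (nonZeroDivisors K[X])
  have : Algebra.EssFiniteType K[X] E := Algebra.EssFiniteType.comp K[X] (RatFunc K) E
  have : Algebra.EssFiniteType K E := Algebra.EssFiniteType.comp K K[X] E
  have : FaithfulSMul K[X] E := (faithfulSMul_iff_algebraMap_injective _ _).2 (by
    rw [IsScalarTower.algebraMap_eq K[X] (RatFunc K) E]
    exact (algebraMap (RatFunc K) E).injective.comp (IsFractionRing.injective K[X] (RatFunc K)))
  have : Algebra.IsAlgebraic K[X] E :=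
    (IsFractionRing.comap_isAlgebraic_iff (A := K[X]) (K := RatFunc K) (C := E)).2 inferInstance
  have : FiniteDimensional (RatFunc B) E := Module.finite_of_finrank_pos (by omega)
  have := aux_main (k := k) (K := K) (B := B) (E := E) (F := RatFunc B)
    (fun p => ⟨_, (hBE _).trans (hKE p)⟩) (algebraMap B[X] E X) (fun p => by
      have : IsScalarTower B B[X] E := IsScalarTower.of_algebraMap_eq fun _ => rfl
      rw [aeval_algebraMap_apply]; simp)
  rwa [hπ] at this



/-- The map `A(x) → B(x)` induced by a field embedding. -/
noncomputable def aux_rfMap {A B : Type*} [Field A] [Field B] (φ : A →+* B) :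
    RatFunc A →+* RatFunc B :=
  RatFunc.mapRingHom (Polynomial.mapRingHom φ)
    (by
      let : Algebra A B := φ.toAlgebra
      exact polyMap_nonZeroDivisors_le A B)

theorem aux_rfMap_algebraMap {A B : Type*} [Field A] [Field B] (φ : A →+* B) (p : A[X]) :
    aux_rfMap φ (algebraMap A[X] (RatFunc A) p) = algebraMap B[X] (RatFunc B) (p.map φ) := by
  let : Algebra A B := φ.toAlgebra
  exact aux_ratFunc_algebraMap A B p

theorem aux_rfMap_C {A B : Type*} [Field A] [Field B] (φ : A →+* B) (a : A) :
    aux_rfMap φ (RatFunc.C a) = RatFunc.C (φ a) := by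
  simpa using aux_rfMap_algebraMap φ (C a)

theorem aux_rfMap_X {A B : Type*} [Field A] [Field B] (φ : A →+* B) :
    aux_rfMap φ RatFunc.X = RatFunc.X := by
  simpa using aux_rfMap_algebraMap φ X

theorem aux_rf_ext {A F : Type*} [Field A] [Field F] {f g : RatFunc A →+* F}
    (hC : ∀ a, f (algebraMap A[X] (RatFunc A) (C a)) = g (algebraMap A[X] (RatFunc A) (C a)))
    (hX : f (algebraMap A[X] (RatFunc A) X) = g (algebraMap A[X] (RatFunc A) X)) : f = g := by
  apply IsLocalization.ringHom_ext (nonZeroDivisors A[X])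
  apply Polynomial.ringHom_ext
  · exact hC
  · exact hX

theorem aux_rfMap_comp {A B D : Type*} [Field A] [Field B] [Field D] (φ : A →+* B) (ψ : B →+* D) :
    (aux_rfMap ψ).comp (aux_rfMap φ) = aux_rfMap (ψ.comp φ) := by
  apply aux_rf_ext <;> intros <;> simp [aux_rfMap_C, aux_rfMap_X]

theorem aux_rfMap_finrank {A B : Type*} [Field A] [Field B] (φ : A →+* B) (hφ : φ.Finite) :
    @Module.finrank (RatFunc A) (RatFunc B) _ _ (aux_rfMap φ).toAlgebra.toModule =
      @Module.finrank A B _ _ φ.toAlgebra.toModule := by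
  let : Algebra A B := φ.toAlgebra
  have : Module.Finite A B := hφ
  let : Algebra A[X] B[X] := Polynomial.algebra A B
  have h := RatFunc.finrank_ratFunc_ratFunc A B
  rw [← h]
  congr 2
  apply Algebra.algebra_ext
  intro r
  refine congrFun (congrArg DFunLike.coe (aux_rf_ext (f := aux_rfMap φ) (g := @algebraMap _ _ _ _ (RatFunc.liftAlgebra A (RatFunc B))) ?_ ?_)) r
  · intro a
    rw [aux_rfMap_algebraMap]
    refine Eq.trans ?_ (IsFractionRing.lift_algebraMap (FaithfulSMul.algebraMap_injective A[X] (RatFunc B)) _).symm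
    rfl
  · rw [aux_rfMap_algebraMap]
    refine Eq.trans ?_ (IsFractionRing.lift_algebraMap (FaithfulSMul.algebraMap_injective A[X] (RatFunc B)) _).symm
    rfl

theorem aux_rfMap_finite {A B : Type*} [Field A] [Field B] (φ : A →+* B) (hφ : φ.Finite) :
    (aux_rfMap φ).Finite := by
  have h := aux_rfMap_finrank φ hφ
  let : Algebra A B := φ.toAlgebra
  have : Module.Finite A B := hφ
  let : Algebra (RatFunc A) (RatFunc B) := (aux_rfMap φ).toAlgebra
  change Module.finrank (RatFunc A) (RatFunc B) = Module.finrank A B at h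
  have : 0 < Module.finrank A B := Module.finrank_pos
  exact Module.finite_of_finrank_pos (R := RatFunc A) (M := RatFunc B) (by omega)

/-- constants. -/
noncomputable def aux_rfC (B : Type*) [Field B] : B →+* RatFunc B :=
  (algebraMap B[X] (RatFunc B)).comp C

/-- variable. -/
noncomputable def aux_rfX (B : Type*) [Field B] : RatFunc B := algebraMap B[X] (RatFunc B) X

theorem aux_swap_inj (B : Type*) [Field B] :
    Function.Injective (eval₂RingHom (aux_rfMap (aux_rfC B)) (aux_rfC (RatFunc B) (aux_rfX B))) := by
  rw [injective_iff_map_eq_zero]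
  intro p hp
  let Φ : B[X][X] →+* RatFunc (RatFunc B) :=
    (algebraMap (RatFunc B)[X] (RatFunc (RatFunc B))).comp (mapRingHom (algebraMap B[X] (RatFunc B)))
  have hΦ : Function.Injective Φ :=
    (IsFractionRing.injective (RatFunc B)[X] (RatFunc (RatFunc B))).comp
      (Polynomial.map_injective _ (IsFractionRing.injective B[X] (RatFunc B)))
  have hs : (eval₂RingHom (aux_rfMap (aux_rfC B)) (aux_rfC (RatFunc B) (aux_rfX B))).comp
      (mapRingHom (algebraMap B[X] (RatFunc B))) = Φ.comp (Polynomial.Bivariate.swap (R := B)).toRingHom := by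
    apply Polynomial.ringHom_ext
    · intro q
      induction q using Polynomial.induction_on' with
      | add p q hp hq => simp only [map_add, hp, hq]
      | monomial n a =>
        simp [← C_mul_X_pow_eq_monomial, Φ, aux_rfC, aux_rfX, aux_rfMap_C, aux_rfMap_X, eval₂_pow, Polynomial.Bivariate.swap_apply]
    · simp [Φ, aux_rfC, aux_rfX, Polynomial.Bivariate.swap_Y]
  obtain ⟨b, hbm, hb⟩ := IsLocalization.integerNormalization_spec (nonZeroDivisors B[X]) p
  set q := IsLocalization.integerNormalization (nonZeroDivisors B[X]) p
  have h1 := congrArg (fun f : B[X][X] →+* RatFunc (RatFunc B) => f q) hs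
  simp only [RingHom.comp_apply, coe_mapRingHom] at h1
  rw [hb, Algebra.smul_def, map_mul, hp, mul_zero] at h1
  have h2 : q = 0 := by
    have := hΦ (h1.symm.trans (map_zero Φ).symm)
    exact (Polynomial.Bivariate.swap (R := B)).injective (this.trans (map_zero _).symm)
  rw [h2, Polynomial.map_zero] at hb
  have hb0 : b ≠ 0 := nonZeroDivisors.ne_zero hbm
  have hb1 : algebraMap B[X] (RatFunc B) b ≠ 0 := fun h0 =>
    hb0 (IsFractionRing.injective B[X] (RatFunc B) (h0.trans (map_zero _).symm))
  rw [← algebraMap_smul (RatFunc B) b p] at hb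
  exact (smul_eq_zero.1 hb.symm).resolve_left hb1

theorem aux_exists_swap (B : Type*) [Field B] :
    ∃ σ : RatFunc (RatFunc B) ≃+* RatFunc (RatFunc B),
      ∀ z, σ (aux_rfC (RatFunc B) z) = aux_rfMap (aux_rfC B) z := by
  let s := IsFractionRing.lift (K := RatFunc (RatFunc B)) (aux_swap_inj B)
  have s1 : ∀ z, s (aux_rfC (RatFunc B) z) = aux_rfMap (aux_rfC B) z := by
    intro z
    refine (IsFractionRing.lift_algebraMap (aux_swap_inj B) (C z)).trans ?_
    simp
  have s2 : s (aux_rfX (RatFunc B)) = aux_rfC (RatFunc B) (aux_rfX B) := by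
    refine (IsFractionRing.lift_algebraMap (aux_swap_inj B) X).trans ?_
    simp
  have s3 : s.comp (aux_rfMap (aux_rfC B)) = aux_rfC (RatFunc B) := by
    apply aux_rf_ext
    · intro a
      rw [RingHom.comp_apply, aux_rfMap_algebraMap, map_C]
      refine (s1 _).trans ?_
      change aux_rfMap _ (algebraMap B[X] (RatFunc B) (C a)) = _
      rw [aux_rfMap_algebraMap, map_C]
      rfl
    · rw [RingHom.comp_apply, aux_rfMap_algebraMap, map_X]
      exact s2
  have s4 : s.comp s = RingHom.id _ := by
    apply aux_rf_ext
    · intro a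
      change s (s (aux_rfC _ a)) = aux_rfC _ a
      rw [s1, ← s3]; rfl
    · change s (s (aux_rfX _)) = aux_rfX _
      rw [s2, s1]
      refine (aux_rfMap_algebraMap _ _).trans ?_
      rw [map_X]; rfl
  exact ⟨RingEquiv.ofRingHom s s s4 s4, s1⟩


theorem aux_rf_essFinite {k B : Type*} [Field k] [Field B] [Algebra k B]
    (hB : Algebra.EssFiniteType k B) :
    @Algebra.EssFiniteType (RatFunc k) (RatFunc B) _ _ (ratFuncAlgebra k B) := by
  let : Algebra (RatFunc k) (RatFunc B) := ratFuncAlgebra k B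
  have : IsScalarTower k (RatFunc k) (RatFunc B) := IsScalarTower.of_algebraMap_eq fun c => by
    rw [aux_ratFunc_const k B, IsScalarTower.algebraMap_apply k k[X] (RatFunc k)]
    refine Eq.trans ?_ (aux_ratFunc_algebraMap k B (C c)).symm
    rw [map_C]
  have : Algebra.EssFiniteType B[X] (RatFunc B) :=
    Algebra.EssFiniteType.of_isLocalization _ (nonZeroDivisors B[X])
  have : Algebra.EssFiniteType B (RatFunc B) := Algebra.EssFiniteType.comp B B[X] (RatFunc B)
  have : Algebra.EssFiniteType k (RatFunc B) := Algebra.EssFiniteType.comp k B (RatFunc B)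
  exact Algebra.EssFiniteType.of_comp k (RatFunc k) (RatFunc B)

/-- Algebra homomorphism out of `B(t)` from a ring homomorphism compatible with constants. -/
noncomputable def aux_mkAlgHom {k B E : Type*} [Field k] [Field B] [Field E] [Algebra k B]
    [Algebra k E] (g : RatFunc B →+* E)
    (hg : ∀ z, g (aux_rfC B (algebraMap k B z)) = algebraMap k E z) : RatFunc B →ₐ[k] E :=
  { toRingHom := g
    commutes' := fun z => by
      refine Eq.trans ?_ (hg z)
      rw [aux_ratFunc_const k B]
      rfl }

theorem aux_dir1 {k : Type u} {K : Type v} [Field k] [Field K] [Algebra k K]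
    (e : ℕ) (he : 0 < e) (h : HasCvgDiagram k K e) :
    @HasCvgDiagram (RatFunc k) (RatFunc K) _ _ (ratFuncAlgebra k K) e := by
  obtain ⟨B, E, _, _, _, _, hB, hE, f, π, hf, hπ⟩ := h
  obtain ⟨σ, hσ⟩ := aux_exists_swap B
  have hB' := aux_rf_essFinite (IntermediateField.fg_top_iff.1 hB)
  have hE' := aux_rf_essFinite (IntermediateField.fg_top_iff.1 hE)
  have hπf : π.toRingHom.Finite := by
    let : Algebra (RatFunc B) E := π.toRingHom.toAlgebra
    change Module.finrank (RatFunc B) E = e at hπ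
    exact Module.finite_of_finrank_pos (R := RatFunc B) (M := E) (by omega)
  have hrank := (aux_rfMap_finrank π.toRingHom hπf).trans hπ
  have hf' := aux_rfMap_finite f.toRingHom hf
  have hconst : (π.toRingHom.comp (aux_rfC B)).comp (algebraMap k B) = algebraMap k E := by
    ext c
    rw [← π.commutes, aux_ratFunc_const k B]
    rfl
  have c1 : ∀ z, aux_rfMap f.toRingHom (aux_rfMap (algebraMap k K) z) =
      aux_rfMap (algebraMap k E) z := by
    intro z
    rw [← RingHom.comp_apply, aux_rfMap_comp]
    congr 2
    exact f.comp_algebraMap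
  have c2 : ∀ z, aux_rfMap π.toRingHom (σ (aux_rfC (RatFunc B) (aux_rfMap (algebraMap k B) z))) =
      aux_rfMap (algebraMap k E) z := by
    intro z
    rw [hσ, ← RingHom.comp_apply, aux_rfMap_comp, ← RingHom.comp_apply, aux_rfMap_comp, hconst]
  let iB : Algebra (RatFunc k) (RatFunc B) := ratFuncAlgebra k B
  let iE : Algebra (RatFunc k) (RatFunc E) := ratFuncAlgebra k E
  let iK : Algebra (RatFunc k) (RatFunc K) := ratFuncAlgebra k K
  refine ⟨RatFunc B, RatFunc E, inferInstance, inferInstance, iB, iE,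
    IntermediateField.fg_top_iff.2 hB', IntermediateField.fg_top_iff.2 hE',
    { toRingHom := aux_rfMap f.toRingHom, commutes' := c1 },
    aux_mkAlgHom ((aux_rfMap π.toRingHom).comp σ.toRingHom) c2, hf', ?_⟩
  · rw [← hrank]
    let i1 : Algebra (RatFunc (RatFunc B)) (RatFunc E) := (aux_rfMap π.toRingHom).toAlgebra
    let i2 : Algebra (RatFunc (RatFunc B)) (RatFunc E) :=
      ((aux_rfMap π.toRingHom).comp σ.toRingHom).toAlgebra
    exact @Algebra.finrank_eq_of_equiv_equiv _ _ _ _ i2 _ _ _ _ i1 σ (RingEquiv.refl _) (by rfl)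


/-- If the field of constants of `K/k` is `k`, then `cvg_{k(x)}(K(x)) = cvg_k(K)`. -/
theorem stmt8 (k : Type u) (K : Type v) [Field k] [Field K] [Algebra k K]
    (hK : IsAlgFunctionField k K) (hconst : algebraicClosure k K = ⊥) :
    cvg (RatFunc k) (RatFunc K) = cvg k K := by
  have hK' : Algebra.EssFiniteType k K := IntermediateField.fg_top_iff.1 hK
  unfold cvg
  by_cases hne : {e : ℕ | 0 < e ∧ HasCvgDiagram k K e}.Nonempty
  · apply le_antisymm
    · have h := Nat.sInf_mem hne
      exact Nat.sInf_le ⟨h.1, aux_dir1 _ h.1 h.2⟩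
    · have hne' : {e : ℕ | 0 < e ∧ HasCvgDiagram (RatFunc k) (RatFunc K) e}.Nonempty := by
        obtain ⟨e, h⟩ := hne
        exact ⟨e, h.1, aux_dir1 _ h.1 h.2⟩
      have h := Nat.sInf_mem hne'
      obtain ⟨e', h0, hle, h'⟩ := aux_dir2 hK' _ h.1 h.2
      exact le_trans (Nat.sInf_le (s := {e : ℕ | 0 < e ∧ HasCvgDiagram k K e}) ⟨h0, h'⟩) hle
  · have h1 : {e : ℕ | 0 < e ∧ HasCvgDiagram k K e} = ∅ := Set.not_nonempty_iff_eq_empty.1 hne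
    have h2 : {e : ℕ | 0 < e ∧ HasCvgDiagram (RatFunc k) (RatFunc K) e} = ∅ := by
      apply Set.eq_empty_of_forall_notMem
      intro e h
      obtain ⟨e', h0, _, h'⟩ := aux_dir2 hK' _ h.1 h.2
      exact hne ⟨e', h0, h'⟩
    rw [h1, h2]
end

section
/- Let K be an algebraic function field over a field k whose field of constants equals k. Let k(x) denote the rational function field in one variable over k and K(x) the rational function field in one variable over K, regarded as an algebraic function field over k(x) via the natural inclusion k(x) ⊆ K(x). Then scvg_{k(x)}(K(x)) = scvg_k(K). -/
universe u v

open scoped nonZeroDivisors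

universe w

section Auxiliary

set_option linter.style.haveILetI false
open Polynomial

/-- Functoriality of `RatFunc`. -/
noncomputable def rmap {E F : Type*} [Field E] [Field F] (φ : E →+* F) : RatFunc E →+* RatFunc F :=
  RatFunc.mapRingHom (Polynomial.mapRingHom φ) (by
    intro p hp
    simp only [Submonoid.mem_comap, Polynomial.coe_mapRingHom]
    rw [mem_nonZeroDivisors_iff_ne_zero] at hp ⊢
    intro h
    exact hp ((Polynomial.map_eq_zero_iff φ.injective).mp h))

theorem rmap_algebraMap {E F : Type*} [Field E] [Field F] (φ : E →+* F) (p : E[X]) :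
    rmap φ (algebraMap E[X] (RatFunc E) p) = algebraMap F[X] (RatFunc F) (p.map φ) := by
  have := RatFunc.map_apply_div_ne_zero (Polynomial.mapRingHom φ) (by
    intro p hp
    simp only [Submonoid.mem_comap, Polynomial.coe_mapRingHom]
    rw [mem_nonZeroDivisors_iff_ne_zero] at hp ⊢
    intro h
    exact hp ((Polynomial.map_eq_zero_iff φ.injective).mp h)) p 1 one_ne_zero
  rw [map_one, div_one, map_one, map_one, div_one] at this
  exact this

theorem rmap_C {E F : Type*} [Field E] [Field F] (φ : E →+* F) (c : E) :
    rmap φ (RatFunc.C c) = RatFunc.C (φ c) := by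
  rw [← RatFunc.algebraMap_C, rmap_algebraMap]; simp

theorem rmap_X {E F : Type*} [Field E] [Field F] (φ : E →+* F) :
    rmap φ RatFunc.X = RatFunc.X := by
  rw [← RatFunc.algebraMap_X, rmap_algebraMap]; simp

theorem ratFunc_hom_ext {E F : Type*} [Field E] [Field F] {σ τ : RatFunc E →+* F}
    (hC : ∀ c, σ (RatFunc.C c) = τ (RatFunc.C c)) (hX : σ RatFunc.X = τ RatFunc.X) : σ = τ := by
  apply IsFractionRing.injective_comp_algebraMap (A := E[X])
  refine Polynomial.ringHom_ext (fun c => ?_) ?_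
  · simpa using hC c
  · simpa using hX

theorem ratFunc_mem {E : Type*} [Field E] (S : Subfield (RatFunc E)) (hC : ∀ c, RatFunc.C c ∈ S)
    (hX : RatFunc.X ∈ S) (z : RatFunc E) : z ∈ S := by
  have key : ∀ p : E[X], algebraMap E[X] (RatFunc E) p ∈ S := by
    intro p
    induction p using Polynomial.induction_on' with
    | add p q hp hq => rw [map_add]; exact add_mem hp hq
    | monomial n a =>
      rw [← Polynomial.C_mul_X_pow_eq_monomial, map_mul, map_pow, RatFunc.algebraMap_C,
        RatFunc.algebraMap_X]
      exact mul_mem (hC a) (pow_mem hX n)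
  rw [← RatFunc.num_div_denom z]
  exact div_mem (key _) (key _)

theorem ratFuncAlgebra_algebraMap (k : Type u) (K : Type v) [Field k] [Field K] [Algebra k K] :
    letI := ratFuncAlgebra k K
    algebraMap (RatFunc k) (RatFunc K) = rmap (algebraMap k K) := rfl

theorem finrank_congr_range {E E' L : Type*} [Field E] [Field E'] [Field L] (σ : E →+* L)
    (τ : E' →+* L) (h : σ.fieldRange = τ.fieldRange) :
    @Module.finrank E L _ _ (letI := σ.toAlgebra; Algebra.toModule) =
    @Module.finrank E' L _ _ (letI := τ.toAlgebra; Algebra.toModule) := by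
  letI := σ.toAlgebra
  letI := τ.toAlgebra
  have h1 : ∀ z : E, ∃ w : E', τ w = σ z := fun z => by
    have : σ z ∈ τ.fieldRange := h ▸ ⟨z, rfl⟩
    simpa using this
  have h2 : ∀ z : E', ∃ w : E, σ w = τ z := fun z => by
    have : τ z ∈ σ.fieldRange := h ▸ ⟨z, rfl⟩
    simpa using this
  choose g hg using h1
  choose g' hg' using h2
  let e : E ≃+* E' :=
    { toFun := g
      invFun := g'
      left_inv := fun z => σ.injective (by rw [hg', hg])
      right_inv := fun z => τ.injective (by rw [hg, hg'])
      map_mul' := fun a b => τ.injective (by simp [hg])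
      map_add' := fun a b => τ.injective (by simp [hg]) }
  refine Algebra.finrank_eq_of_equiv_equiv e (RingEquiv.refl L) ?_
  ext z
  exact hg z

theorem linearIndependent_ratFunc {E F : Type*} [Field E] [Field F] [Algebra E F] {ι : Type*}
    {w : ι → F} (hw : LinearIndependent E w) :
    letI := (rmap (algebraMap E F)).toAlgebra
    LinearIndependent (RatFunc E) (fun i => RatFunc.C (w i) : ι → RatFunc F) := by
  letI := (rmap (algebraMap E F)).toAlgebra
  letI : Algebra E[X] (RatFunc F) :=
    ((rmap (algebraMap E F)).comp (algebraMap E[X] (RatFunc E))).toAlgebra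
  haveI : IsScalarTower E[X] (RatFunc E) (RatFunc F) := IsScalarTower.of_algebraMap_eq fun _ => rfl
  rw [← LinearIndependent.iff_fractionRing E[X] (RatFunc E), linearIndependent_iff']
  intro s g hg i hi
  have h1 : ∑ i ∈ s, (g i).map (algebraMap E F) * C (w i) = 0 := by
    apply IsFractionRing.injective F[X] (RatFunc F)
    rw [map_sum, map_zero, ← hg]
    refine Finset.sum_congr rfl fun i _ => ?_
    rw [map_mul, Algebra.smul_def, RatFunc.algebraMap_C]
    congr 1
    exact (rmap_algebraMap _ _).symm
  ext j
  rw [linearIndependent_iff'] at hw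
  refine hw s (fun i => (g i).coeff j) ?_ i hi
  have := congrArg (fun p => p.coeff j) h1
  simpa [Polynomial.finsetSum_coeff, Algebra.smul_def] using this

theorem transcendental_ratFunc {E F : Type*} [Field E] [Field F] [Algebra E F] {t : F}
    (ht : Transcendental E t) :
    letI := (rmap (algebraMap E F)).toAlgebra
    Transcendental (RatFunc E) (RatFunc.C t : RatFunc F) := by
  letI := (rmap (algebraMap E F)).toAlgebra
  have hw : LinearIndependent E (fun n : ℕ => t ^ n) := by
    rw [linearIndependent_iff']
    intro s g hg i hi
    rw [transcendental_iff] at ht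
    have := ht (∑ i ∈ s, monomial i (g i)) (by simpa [Algebra.smul_def, aeval_monomial] using hg)
    have := congrArg (fun p => p.coeff i) this
    simpa [Polynomial.finsetSum_coeff, coeff_monomial, hi] using this
  have h2 := linearIndependent_ratFunc hw
  rw [linearIndependent_iff'] at h2
  rw [transcendental_iff]
  intro p hp
  ext i
  rw [aeval_eq_sum_range] at hp
  by_cases hi : i ∈ Finset.range (p.natDegree + 1)
  · refine h2 _ (fun i => p.coeff i) ?_ i hi
    simpa using hp
  · rw [Finset.mem_range, not_lt] at hi
    exact coeff_eq_zero_of_natDegree_lt (by omega)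

theorem finrank_rmap {E F : Type*} [Field E] [Field F] (φ : E →+* F)
    (hφ : letI := φ.toAlgebra; Algebra.IsAlgebraic E F) :
    @Module.finrank (RatFunc E) (RatFunc F) _ _ (letI := (rmap φ).toAlgebra; Algebra.toModule) =
    @Module.finrank E F _ _ (letI := φ.toAlgebra; Algebra.toModule) := by
  letI := φ.toAlgebra
  haveI : Algebra.IsAlgebraic E F := hφ
  letI := Polynomial.algebra E F
  rw [← RatFunc.finrank_ratFunc_ratFunc E F]
  congr 1
  have : (rmap φ).toAlgebra = RatFunc.liftAlgebra E (RatFunc F) := by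
    apply Algebra.algebra_ext
    intro r
    have : rmap φ = IsFractionRing.lift (FaithfulSMul.algebraMap_injective E[X] (RatFunc F)) := by
      apply ratFunc_hom_ext
      · intro c
        rw [rmap_C, ← RatFunc.algebraMap_C (K := E), IsFractionRing.lift_algebraMap]
        rw [IsScalarTower.algebraMap_apply E[X] F[X] (RatFunc F)]
        simp [RingHom.algebraMap_toAlgebra]
      · rw [rmap_X, ← RatFunc.algebraMap_X (K := E), IsFractionRing.lift_algebraMap]
        rw [IsScalarTower.algebraMap_apply E[X] F[X] (RatFunc F)]
        simp
    exact congrArg (fun σ : RatFunc E →+* RatFunc F => σ r) this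
  rw [this]

/-- The embedding of `B(t)` attached to a transcendental element. -/
noncomputable def liftT {B L : Type*} [Field B] [Field L] [Algebra B L] (t : L)
    (ht : Transcendental B t) : RatFunc B →ₐ[B] L :=
  (IntermediateField.val _).comp (RatFunc.algEquivOfTranscendental t ht).toAlgHom

theorem liftT_X {B L : Type*} [Field B] [Field L] [Algebra B L] (t : L)
    (ht : Transcendental B t) : liftT t ht RatFunc.X = t := by
  simp [liftT]

theorem liftT_algebraMap {B L : Type*} [Field B] [Field L] [Algebra B L] (t : L)
    (ht : Transcendental B t) (p : B[X]) : liftT t ht (algebraMap _ _ p) = aeval t p := by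
  simp [liftT]

theorem liftT_C {B L : Type*} [Field B] [Field L] [Algebra B L] (t : L)
    (ht : Transcendental B t) (c : B) : liftT t ht (RatFunc.C c) = algebraMap B L c := by
  rw [← RatFunc.algebraMap_C, liftT_algebraMap]; simp

theorem essFiniteType_ratFunc (E : Type*) [Field E] : Algebra.EssFiniteType E (RatFunc E) := by
  haveI : Algebra.EssFiniteType E[X] (RatFunc E) := .of_isLocalization _ (nonZeroDivisors _)
  exact .comp _ E[X] _

theorem isAlgFunctionField_ratFunc {k : Type u} {E : Type v} [Field k] [Field E] [Algebra k E]
    (h : IsAlgFunctionField k E) :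
    letI := ratFuncAlgebra k E
    IsAlgFunctionField (RatFunc k) (RatFunc E) := by
  letI := ratFuncAlgebra k E
  unfold IsAlgFunctionField at *
  rw [IntermediateField.fg_top_iff] at *
  haveI := essFiniteType_ratFunc E
  haveI : Algebra.EssFiniteType k (RatFunc E) := .comp _ E _
  haveI : IsScalarTower k (RatFunc k) (RatFunc E) := IsScalarTower.of_algebraMap_eq fun c => by
    rw [ratFuncAlgebra_algebraMap, IsScalarTower.algebraMap_apply k E (RatFunc E),
      RatFunc.algebraMap_eq_C, RatFunc.algebraMap_eq_C, rmap_C]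
  exact .of_comp k _ _

theorem isSeparable_rmap {E F : Type*} [Field E] [Field F] (φ : E →+* F)
    (h : letI := φ.toAlgebra; Algebra.IsSeparable E F) :
    letI := (rmap φ).toAlgebra; Algebra.IsSeparable (RatFunc E) (RatFunc F) := by
  letI := φ.toAlgebra
  haveI : Algebra.IsSeparable E F := h
  letI := (rmap φ).toAlgebra
  constructor
  intro z
  have key : z ∈ (separableClosure (RatFunc E) (RatFunc F)).toSubfield := by
    apply ratFunc_mem
    · intro c
      change RatFunc.C c ∈ separableClosure (RatFunc E) (RatFunc F)
      rw [mem_separableClosure_iff]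
      have h1 : IsSeparable E c := Algebra.IsSeparable.isSeparable E c
      have h2 : ((minpoly E c).map (RatFunc.C (K := E))).Separable := Polynomial.Separable.map h1
      refine h2.of_dvd (minpoly.dvd _ _ ?_)
      have h3 := minpoly.aeval E c
      rw [aeval_def, eval₂_map]
      have h4 : (algebraMap (RatFunc E) (RatFunc F)).comp RatFunc.C = RatFunc.C.comp φ := by
        ext d
        exact rmap_C φ d
      rw [h4, ← hom_eval₂]
      rw [aeval_def] at h3
      exact (congrArg _ h3).trans (map_zero _)
    · change RatFunc.X ∈ separableClosure (RatFunc E) (RatFunc F)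
      rw [mem_separableClosure_iff, ← rmap_X φ]
      exact isSeparable_algebraMap _
  exact mem_separableClosure_iff.mp key

theorem finite_rmap {E F : Type*} [Field E] [Field F] (φ : E →+* F) (h : φ.Finite) :
    (rmap φ).Finite := by
  letI := φ.toAlgebra
  haveI : Module.Finite E F := h
  letI := (rmap φ).toAlgebra
  have h1 : Module.finrank (RatFunc E) (RatFunc F) = Module.finrank E F :=
    finrank_rmap φ inferInstance
  have : Module.Finite (RatFunc E) (RatFunc F) := by
    apply Module.finite_of_finrank_pos
    rw [h1]
    exact Module.finrank_pos
  exact this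

theorem transcendental_of_ratFunc_hom {B L : Type*} [Field B] [Field L] [Algebra B L]
    (π : RatFunc B →ₐ[B] L) : Transcendental B (π RatFunc.X) := by
  rw [transcendental_iff]
  intro p hp
  rw [← RatFunc.algebraMap_X, aeval_algHom_apply, map_eq_zero, aeval_algebraMap_apply,
    aeval_X_left_apply] at hp
  exact (map_eq_zero_iff _ (IsFractionRing.injective B[X] (RatFunc B))).mp hp

theorem forward {k : Type u} {K : Type v} [Field k] [Field K] [Algebra k K] {e : ℕ} (he : 0 < e)
    (h : HasSepCvgDiagram k K e) :
    letI := ratFuncAlgebra k K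
    HasSepCvgDiagram (RatFunc k) (RatFunc K) e := by
  letI := ratFuncAlgebra k K
  obtain ⟨B, L, _, _, _, _, hB, hL, f, π, hf, hs, hr⟩ := h
  letI algBL : Algebra B L := (π.toRingHom.comp (RatFunc.C (K := B))).toAlgebra
  haveI : IsScalarTower k B L := IsScalarTower.of_algebraMap_eq fun c => by
    change _ = π (RatFunc.C (algebraMap k B c))
    rw [← RatFunc.algebraMap_eq_C, ← IsScalarTower.algebraMap_apply k B (RatFunc B), π.commutes]
  let πB : RatFunc B →ₐ[B] L := { π.toRingHom with
    commutes' := fun c => by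
      rw [RatFunc.algebraMap_eq_C]
      rfl }
  have ht : Transcendental B (π RatFunc.X) := transcendental_of_ratFunc_hom πB
  have hT := transcendental_ratFunc ht
  have hTow : ∀ z : RatFunc k, rmap (algebraMap k L) z =
      rmap (algebraMap B L) (rmap (algebraMap k B) z) := by
    intro z
    have : rmap (algebraMap k L) = (rmap (algebraMap B L)).comp (rmap (algebraMap k B)) := by
      apply ratFunc_hom_ext
      · intro c
        simp only [RingHom.comp_apply, rmap_C]
        rw [IsScalarTower.algebraMap_apply k B L]
      · simp only [RingHom.comp_apply, rmap_X]
    rw [this]; rfl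
  letI := ratFuncAlgebra k B
  letI := ratFuncAlgebra k L
  let fK : RatFunc K →ₐ[RatFunc k] RatFunc L :=
    { rmap f.toRingHom with
      commutes' := fun z => by
        change rmap f.toRingHom (rmap (algebraMap k K) z) = rmap (algebraMap k L) z
        have : rmap (algebraMap k L) = (rmap f.toRingHom).comp (rmap (algebraMap k K)) := by
          apply ratFunc_hom_ext
          · intro c
            simp only [RingHom.comp_apply, rmap_C]
            congr 1
            exact (f.commutes c).symm
          · simp only [RingHom.comp_apply, rmap_X]
        rw [this]; rfl }
  let algBLx : Algebra (RatFunc B) (RatFunc L) := (rmap (algebraMap B L)).toAlgebra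
  let π' : RatFunc (RatFunc B) →ₐ[RatFunc k] RatFunc L :=
    { (liftT (RatFunc.C (π RatFunc.X)) hT).toRingHom with
      commutes' := fun z => by
        change liftT (RatFunc.C (π RatFunc.X)) hT (algebraMap (RatFunc k) (RatFunc (RatFunc B)) z)
          = rmap (algebraMap k L) z
        rw [IsScalarTower.algebraMap_apply (RatFunc k) (RatFunc B) (RatFunc (RatFunc B)),
          RatFunc.algebraMap_eq_C, liftT_C, hTow]
        rfl }
  refine ⟨RatFunc B, RatFunc L, inferInstance, inferInstance, ratFuncAlgebra k B,
    ratFuncAlgebra k L, isAlgFunctionField_ratFunc hB, isAlgFunctionField_ratFunc hL, fK, π',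
    finite_rmap _ hf, isSeparable_rmap _ hs, ?_⟩
  have halg : letI := π.toRingHom.toAlgebra; Algebra.IsAlgebraic (RatFunc B) L := by
    letI := π.toRingHom.toAlgebra
    haveI : Module.Finite (RatFunc B) L := Module.finite_of_finrank_pos (hr ▸ he)
    infer_instance
  rw [← hr]
  refine Eq.trans ?_ (finrank_rmap π.toRingHom halg)
  apply finrank_congr_range
  have e1 : ∀ z, π'.toRingHom (RatFunc.C z) = rmap (algebraMap B L) z := fun z =>
    liftT_C _ hT z
  have e2 : π'.toRingHom RatFunc.X = RatFunc.C (π RatFunc.X) := liftT_X _ hT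
  apply le_antisymm
  · suffices ∀ z, z ∈ ((rmap π.toRingHom).fieldRange.comap π'.toRingHom) by
      rintro _ ⟨z, rfl⟩
      exact this z
    apply ratFunc_mem
    · suffices ∀ z, z ∈ ((rmap π.toRingHom).fieldRange.comap (rmap (algebraMap B L))) by
        intro c
        rw [Subfield.mem_comap, e1]
        exact this c
      apply ratFunc_mem
      · intro c
        rw [Subfield.mem_comap, rmap_C]
        exact ⟨RatFunc.C (RatFunc.C c), rmap_C _ _⟩
      · rw [Subfield.mem_comap, rmap_X]
        exact ⟨RatFunc.X, rmap_X _⟩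
    · rw [Subfield.mem_comap, e2]
      exact ⟨RatFunc.C RatFunc.X, rmap_C _ _⟩
  · suffices ∀ z, z ∈ (π'.toRingHom.fieldRange.comap (rmap π.toRingHom)) by
      rintro _ ⟨z, rfl⟩
      exact this z
    apply ratFunc_mem
    · suffices ∀ z, z ∈ (π'.toRingHom.fieldRange.comap (RatFunc.C.comp π.toRingHom)) by
        intro c
        rw [Subfield.mem_comap, rmap_C]
        exact this c
      apply ratFunc_mem
      · intro c
        refine ⟨RatFunc.C (RatFunc.C c), ?_⟩
        rw [e1, rmap_C]; rfl
      · exact ⟨RatFunc.X, e2⟩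
    · rw [Subfield.mem_comap, rmap_X]
      refine ⟨RatFunc.C RatFunc.X, ?_⟩
      rw [e1, rmap_X]

theorem infinite_separable (k Ω : Type*) [Field k] [Field Ω] [Algebra k Ω] [IsAlgClosed Ω] :
    {a : Ω | IsSeparable k a}.Infinite := by
  by_cases hk : Finite k
  · haveI : PerfectField k := inferInstance
    have h1 : IsAlgClosure k (algebraicClosure k Ω) := inferInstance
    haveI := h1.isAlgClosed
    have h2 : Infinite (algebraicClosure k Ω) := inferInstance
    have h3 : (algebraicClosure k Ω : Set Ω).Infinite := Set.infinite_coe_iff.mp h2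
    refine h3.mono ?_
    intro a ha
    have : IsAlgebraic k a := mem_algebraicClosure_iff.mp ha
    exact (PerfectField.separable_of_irreducible (minpoly.irreducible this.isIntegral))
  · haveI : Infinite k := not_finite_iff_infinite.mp hk
    refine (Set.infinite_range_of_injective (algebraMap k Ω).injective).mono ?_
    rintro _ ⟨c, rfl⟩
    exact isSeparable_algebraMap _

theorem exists_sep_ne (k : Type*) {K Ω : Type*} [Field k] [Field K] [Field Ω] [Algebra k Ω]
    [Algebra K Ω] [IsAlgClosed Ω] (D : K[X]) (hD : D ≠ 0) :
    ∃ a : Ω, IsSeparable k a ∧ aeval a D ≠ 0 := by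
  classical
  have h0 : D.map (algebraMap K Ω) ≠ 0 := (Polynomial.map_ne_zero_iff (algebraMap K Ω).injective).mpr hD
  have := (infinite_separable k Ω).exists_notMem_finset (D.map (algebraMap K Ω)).roots.toFinset
  obtain ⟨a, ha, h⟩ := this
  refine ⟨a, ha, fun h2 => h ?_⟩
  rw [Multiset.mem_toFinset, mem_roots h0, IsRoot, eval_map_algebraMap, h2]

/-- Hensel: embed `L` into the fraction field of a Henselian domain. -/
theorem hensel_embed {K L R Q : Type*} [Field K] [Field L] [CommRing R] [IsDomain R] [Field Q]
    [Algebra R Q] [IsFractionRing R Q] [Algebra (RatFunc K) L] (I : Ideal R) [HenselianRing R I]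
    (ι : K[X] →+* R) (hι : Function.Injective ι) (y : L)
    (hy : IntermediateField.adjoin (RatFunc K) {y} = ⊤) (hyi : IsIntegral (RatFunc K) y)
    (G : K[X][X]) (hG : G.Monic)
    (hGy : G.map (algebraMap K[X] (RatFunc K)) = minpoly (RatFunc K) y)
    (α : R) (h1 : (G.map ι).eval α ∈ I)
    (h2 : IsUnit (Ideal.Quotient.mk I ((G.map ι).derivative.eval α))) :
    ∃ ψ : L →+* Q, ∀ p : K[X], ψ (algebraMap (RatFunc K) L (algebraMap K[X] (RatFunc K) p)) =
      algebraMap R Q (ι p) := by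
  obtain ⟨β, hβ, -⟩ := HenselianRing.is_henselian (G.map ι) (hG.map _) α h1 h2
  have hinj : Function.Injective ((algebraMap R Q).comp ι) :=
    (IsFractionRing.injective R Q).comp hι
  let σ : RatFunc K →+* Q := IsFractionRing.lift hinj
  have hσ : ∀ p, σ (algebraMap K[X] (RatFunc K) p) = algebraMap R Q (ι p) := fun p =>
    IsFractionRing.lift_algebraMap hinj p
  letI := σ.toAlgebra
  have hroot : algebraMap R Q β ∈ (minpoly (RatFunc K) y).aroots Q := by
    rw [mem_aroots]
    refine ⟨minpoly.ne_zero hyi, ?_⟩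
    rw [← hGy, aeval_def, eval₂_map]
    have : (algebraMap (RatFunc K) Q).comp (algebraMap K[X] (RatFunc K)) =
        (algebraMap R Q).comp ι := RingHom.ext hσ
    rw [this, ← eval₂_map, eval₂_hom, IsRoot.def.mp hβ, map_zero]
  let φ := (IntermediateField.algHomAdjoinIntegralEquiv (RatFunc K) (K := Q) hyi).symm
    ⟨_, hroot⟩
  let e : L ≃ₐ[RatFunc K] IntermediateField.adjoin (RatFunc K) {y} :=
    IntermediateField.topEquiv.symm.trans (IntermediateField.equivOfEq hy.symm)
  refine ⟨(φ.comp e.toAlgHom).toRingHom, fun p => ?_⟩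
  rw [← hσ]
  exact (φ.comp e.toAlgHom).commutes _

theorem clear_denom {K : Type*} [Field K] (P : (RatFunc K)[X]) :
    ∃ (b : K[X]) (P' : K[X][X]), b ≠ 0 ∧
      P'.map (algebraMap K[X] (RatFunc K)) = C (algebraMap K[X] (RatFunc K) b) * P := by
  obtain ⟨b, hb0, hb⟩ := IsLocalization.integerNormalization_spec (K[X]⁰) P
  refine ⟨b, _, nonZeroDivisors.ne_zero hb0, hb.trans ?_⟩
  rw [← smul_eq_C_mul, algebraMap_smul]

theorem exists_disc {K L : Type*} [Field K] [Field L] [Algebra (RatFunc K) L]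
    [FiniteDimensional (RatFunc K) L] [Algebra.IsSeparable (RatFunc K) L] :
    ∃ (y : L) (G : K[X][X]) (A B : K[X][X]) (δ : K[X]),
      IntermediateField.adjoin (RatFunc K) {y} = ⊤ ∧ G.Monic ∧
      G.map (algebraMap K[X] (RatFunc K)) = minpoly (RatFunc K) y ∧ δ ≠ 0 ∧
      A * G + B * derivative G = C δ := by
  letI : Algebra K[X] L :=
    ((algebraMap (RatFunc K) L).comp (algebraMap K[X] (RatFunc K))).toAlgebra
  haveI : IsScalarTower K[X] (RatFunc K) L := IsScalarTower.of_algebraMap_eq fun _ => rfl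
  obtain ⟨y0, hy0⟩ := Field.exists_primitive_element (RatFunc K) L
  have h1 : IsAlgebraic K[X] y0 :=
    (IsFractionRing.isAlgebraic_iff K[X] (RatFunc K) L).mpr (Algebra.IsAlgebraic.isAlgebraic y0)
  obtain ⟨d, hd, hi⟩ := h1.exists_integral_multiple
  set y := d • y0 with hy
  have hd' : algebraMap K[X] (RatFunc K) d ≠ 0 := by simpa using hd
  have hadj : IntermediateField.adjoin (RatFunc K) {y} = ⊤ := by
    rw [eq_top_iff, ← hy0, IntermediateField.adjoin_simple_le_iff]
    have : y0 = (algebraMap K[X] (RatFunc K) d)⁻¹ • y := by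
      rw [hy, ← algebraMap_smul (RatFunc K) d y0, smul_smul, inv_mul_cancel₀ hd', one_smul]
    rw [this]
    exact IntermediateField.smul_mem _ (IntermediateField.mem_adjoin_simple_self _ _)
  have hG := minpoly.isIntegrallyClosed_eq_field_fractions' (RatFunc K) hi
  have hsep : (minpoly (RatFunc K) y).Separable := Algebra.IsSeparable.isSeparable _ y
  obtain ⟨P, Q, hPQ⟩ := hsep
  obtain ⟨b, P', hb, hP⟩ := clear_denom P
  obtain ⟨c, Q', hc, hQ⟩ := clear_denom Q
  refine ⟨y, minpoly K[X] y, C c * P', C b * Q', b * c, hadj, minpoly.monic hi, hG.symm,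
    mul_ne_zero hb hc, ?_⟩
  apply Polynomial.map_injective (algebraMap K[X] (RatFunc K)) (IsFractionRing.injective _ _)
  simp only [Polynomial.map_add, Polynomial.map_mul, Polynomial.map_C, hP, hQ, map_mul,
    ← Polynomial.derivative_map, ← hG]
  linear_combination (C (algebraMap K[X] (RatFunc K) b) * C (algebraMap K[X] (RatFunc K) c)) * hPQ

theorem exists_embed (k : Type*) {K L Ω : Type*} [Field k] [Field K] [Field L] [Field Ω]
    [Algebra k K] [Algebra K Ω] [Algebra k Ω] [IsScalarTower k K Ω] [IsAlgClosed Ω]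
    [Algebra (RatFunc K) L] [FiniteDimensional (RatFunc K) L] [Algebra.IsSeparable (RatFunc K) L]
    (D : K[X]) (hD : D ≠ 0) :
    ∃ (a : Ω) (K' : IntermediateField K Ω) (ι : K[X] →+* PowerSeries K')
      (ψ : L →+* LaurentSeries K'), IsSeparable k a ∧ aeval a D ≠ 0 ∧
      FiniteDimensional K K' ∧ Algebra.IsSeparable K K' ∧
      (∀ p, ψ (algebraMap (RatFunc K) L (algebraMap K[X] (RatFunc K) p)) =
        algebraMap (PowerSeries K') (LaurentSeries K') (ι p)) ∧
      ∀ p, ((PowerSeries.constantCoeff (ι p) : K') : Ω) = aeval a p := by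
  obtain ⟨y, G, A, B, δ, hy, hG, hGy, hδ, hAB⟩ := exists_disc (K := K) (L := L)
  obtain ⟨a, ha, haD⟩ := exists_sep_ne k (Ω := Ω) (D * δ) (mul_ne_zero hD hδ)
  rw [map_mul] at haD
  have haδ := right_ne_zero_of_mul haD
  have hyi : IsIntegral (RatFunc K) y := Algebra.IsIntegral.isIntegral y
  let ev : K[X] →+* Ω := (aeval a : K[X] →ₐ[K] Ω).toRingHom
  have hdeg : (G.map ev).degree ≠ 0 := by
    rw [hG.degree_map, ← hG.degree_map (algebraMap K[X] (RatFunc K)), hGy]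
    exact (minpoly.degree_pos hyi).ne'
  obtain ⟨α, hα⟩ := IsAlgClosed.exists_root (G.map ev) hdeg
  have hAB' := congrArg (fun p => (p.map ev).eval α) hAB
  have hev : ∀ p, ev p = aeval a p := fun _ => rfl
  simp only [Polynomial.map_add, Polynomial.map_mul, Polynomial.map_C, eval_add, eval_mul,
    eval_C, hα.eq_zero, mul_zero, zero_add] at hAB'
  have hder : ((derivative G).map ev).eval α ≠ 0 := by
    intro h0
    rw [h0, mul_zero] at hAB'
    exact haδ hAB'.symm
  have haK : IsSeparable K a := IsSeparable.tower_top K ha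
  -- separability of the root
  have hαK : IsSeparable K α := by
    let E := separableClosure K Ω
    let aE : E := ⟨a, mem_separableClosure_iff.mpr haK⟩
    let evE : K[X] →+* E := (aeval aE : K[X] →ₐ[K] E).toRingHom
    have hevE : (algebraMap E Ω).comp evE = ev := by
      apply Polynomial.ringHom_ext
      · intro c
        simp [evE, hev]
      · simp [evE, hev]
        rfl
    have hsE : (G.map evE).Separable := by
      have hδE : evE δ ≠ 0 := by
        intro h
        apply haδ
        have : ev δ = 0 := by rw [← hevE, RingHom.comp_apply, h, map_zero]
        exact this
      have h := congrArg (fun p => p.map evE) hAB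
      simp only [Polynomial.map_add, Polynomial.map_mul, Polynomial.map_C] at h
      rw [separable_def']
      refine ⟨C (evE δ)⁻¹ * A.map evE, C (evE δ)⁻¹ * B.map evE, ?_⟩
      rw [derivative_map, mul_assoc, mul_assoc, ← mul_add, h, ← C_mul, inv_mul_cancel₀ hδE, C_1]
    have : IsSeparable E α := by
      refine hsE.of_dvd (minpoly.dvd _ _ ?_)
      rw [aeval_def, eval₂_map, hevE, ← eval_map]
      exact hα
    exact IsSeparable.of_algebra_isSeparable_of_isSeparable K this
  let K' : IntermediateField K Ω := IntermediateField.adjoin K {a, α}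
  have hmem : ∀ x ∈ ({a, α} : Set Ω), IsSeparable K x := by
    rintro x (rfl | rfl)
    · exact haK
    · exact hαK
  have hfin : FiniteDimensional K K' :=
    IntermediateField.finiteDimensional_adjoin fun x hx => (hmem x hx).isIntegral
  have hsep : Algebra.IsSeparable K K' :=
    (IntermediateField.isSeparable_adjoin_iff_isSeparable _ _).mpr hmem
  let a' : K' := ⟨a, IntermediateField.subset_adjoin _ _ (by simp)⟩
  let α' : K' := ⟨α, IntermediateField.subset_adjoin _ _ (by simp)⟩
  let ι : K[X] →+* PowerSeries K' := ((Polynomial.coeToPowerSeries.ringHom (R := K')).comp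
    (taylorAlgHom a').toRingHom).comp (mapRingHom (algebraMap K K'))
  have hι : ∀ p, ι p = ((taylor a' (p.map (algebraMap K K')) : K'[X]) : PowerSeries K') :=
    fun p => rfl
  have hιinj : Function.Injective ι := by
    intro p q hpq
    rw [hι, hι] at hpq
    exact Polynomial.map_injective _ (algebraMap K K').injective
      (taylor_injective _ (Polynomial.coe_injective _ hpq))
  have hcc : ∀ p, ((PowerSeries.constantCoeff (ι p) : K') : Ω) = aeval a p := by
    intro p
    rw [hι, Polynomial.constantCoeff_coe, taylor_coeff_zero, eval_map_algebraMap]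
    exact (aeval_algebraMap_apply Ω a' p).symm
  have hcc' : ((algebraMap K' Ω).comp (PowerSeries.constantCoeff (R := K'))).comp ι = ev := RingHom.ext hcc
  have hkey : ∀ H : K[X][X], ((PowerSeries.constantCoeff ((H.map ι).eval (PowerSeries.C α')) : K') : Ω)
      = (H.map ev).eval α := by
    intro H
    change algebraMap K' Ω _ = _
    rw [← RingHom.comp_apply, eval_map, hom_eval₂, hcc', eval_map]
    simp [α']
  obtain ⟨ψ, hψ⟩ := hensel_embed (L := L) (Q := LaurentSeries K')
    (Ideal.span {(PowerSeries.X : PowerSeries K')}) ι hιinj y hy hyi G hG hGy (PowerSeries.C α')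
    (by
      rw [Ideal.mem_span_singleton, PowerSeries.X_dvd_iff]
      apply (algebraMap K' Ω).injective
      rw [map_zero]
      exact (hkey G).trans hα)
    (by
      apply IsUnit.map
      rw [PowerSeries.isUnit_iff_constantCoeff, isUnit_iff_ne_zero, derivative_map]
      intro h0
      apply hder
      rw [← hkey, h0]
      rfl)
  exact ⟨a, K', ι, ψ, ha, left_ne_zero_of_mul haD, hfin, hsep, hψ, hcc⟩

/-- A place of `L` with values in `Ω`. -/
structure Plc (L Ω : Type*) [Field L] [Field Ω] where
  O : ValuationSubring L
  ρ : O →+* Ω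
  isUnit' : ∀ w : O, ρ w ≠ 0 → (w : L)⁻¹ ∈ O

theorem exists_place (k : Type*) {K L Ω : Type*} [Field k] [Field K] [Field L] [Field Ω]
    [Algebra k K] [Algebra K Ω] [Algebra k Ω] [IsScalarTower k K Ω] [IsAlgClosed Ω]
    [Algebra (RatFunc K) L] [FiniteDimensional (RatFunc K) L] [Algebra.IsSeparable (RatFunc K) L]
    (S : Finset L) :
    ∃ (P : Plc L Ω) (K' : IntermediateField K Ω) (a : Ω), 
      FiniteDimensional K K' ∧ Algebra.IsSeparable K K' ∧ IsAlgebraic k a ∧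
      (∀ w, P.ρ w ∈ K') ∧
      (∀ p : K[X], ∃ w : P.O, (w : L) = algebraMap (RatFunc K) L (algebraMap K[X] (RatFunc K) p) ∧
        P.ρ w = aeval a p) ∧ 
      ∀ s ∈ S, s ∈ P.O := by
  classical
  letI : Algebra K[X] L :=
    ((algebraMap (RatFunc K) L).comp (algebraMap K[X] (RatFunc K))).toAlgebra
  haveI : IsScalarTower K[X] (RatFunc K) L := IsScalarTower.of_algebraMap_eq fun _ => rfl
  have h1 : ∀ s : L, ∃ d : K[X], d ≠ 0 ∧ IsIntegral K[X] (d • s) := fun s => by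
    have h1 : IsAlgebraic K[X] s :=
      (IsFractionRing.isAlgebraic_iff K[X] (RatFunc K) L).mpr (Algebra.IsAlgebraic.isAlgebraic s)
    obtain ⟨d, hd, h⟩ := h1.exists_integral_multiple
    exact ⟨d, hd, h⟩
  choose d hd hdi using h1
  obtain ⟨a, K', ι, ψ, ha, haD, hfin, hsep, hψ, hcc⟩ := exists_embed k (K := K) (L := L) (Ω := Ω)
    (∏ s ∈ S, d s) (Finset.prod_ne_zero_iff.mpr fun s _ => hd s)
  rw [map_prod, Finset.prod_ne_zero_iff] at haD
  let am := algebraMap (PowerSeries K') (LaurentSeries K')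
  have hinj : Function.Injective am := IsFractionRing.injective _ _
  have hval : ∀ z : LaurentSeries K', (∃ p, am p = z) ∨ (∃ p, am p = z⁻¹) := by
    intro z
    haveI : ValuationRing (PowerSeries K') := inferInstance
    rcases (ValuationRing.isInteger_or_isInteger (PowerSeries K') z) with h | h
    · exact Or.inl h
    · exact Or.inr h
  let O : ValuationSubring L :=
    { (am.range.comap ψ) with
      mem_or_inv_mem' := fun z => by
        rcases hval (ψ z) with ⟨p, hp⟩ | ⟨p, hp⟩
        · exact Or.inl ⟨p, hp⟩
        · refine Or.inr ⟨p, ?_⟩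
          rw [hp, map_inv₀] }
  have hO : ∀ z, z ∈ O ↔ ∃ p, am p = ψ z := fun z => Iff.rfl
  choose g hg using fun z : O => (hO z).mp z.2
  let gh : O →+* PowerSeries K' :=
    { toFun := g
      map_one' := hinj (by rw [hg]; simp)
      map_mul' := fun x y => hinj (by rw [hg, map_mul, hg, hg]; simp)
      map_zero' := hinj (by rw [hg]; simp)
      map_add' := fun x y => hinj (by rw [hg, map_add, hg, hg]; simp) }
  let P : Plc L Ω :=
    { O := O
      ρ := ((algebraMap K' Ω).comp (PowerSeries.constantCoeff (R := K'))).comp gh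
      isUnit' := fun w hw => by
        have h1 : IsUnit (g w) := by
          rw [PowerSeries.isUnit_iff_constantCoeff, isUnit_iff_ne_zero]
          intro h0
          apply hw
          change algebraMap K' Ω (PowerSeries.constantCoeff (g w)) = 0
          rw [h0, map_zero]
        obtain ⟨v, hv⟩ := h1
        refine (hO _).mpr ⟨↑v⁻¹, ?_⟩
        rw [map_inv₀, ← hg, ← hv]
        exact eq_inv_of_mul_eq_one_left (by rw [← map_mul]; simp) }
  have hP : ∀ p : K[X], ∃ w : P.O,
      (w : L) = algebraMap (RatFunc K) L (algebraMap K[X] (RatFunc K) p) ∧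
        P.ρ w = aeval a p := by
    intro p
    refine ⟨⟨algebraMap (RatFunc K) L (algebraMap K[X] (RatFunc K) p), ι p, (hψ p).symm⟩, rfl, ?_⟩
    rw [← hcc]
    have hgp : ∀ z : O, (z : L) = algebraMap (RatFunc K) L (algebraMap K[X] (RatFunc K) p) →
        g z = ι p := fun z hz => hinj (by rw [hg, hz]; exact hψ p)
    change algebraMap K' Ω (PowerSeries.constantCoeff (g _)) = _
    rw [hgp _ rfl]
    rfl
  refine ⟨P, K', a, hfin, hsep, ?_, fun w => (PowerSeries.constantCoeff (g w)).2, hP, ?_⟩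
  · exact ha.isIntegral.isAlgebraic
  · intro s hs
    obtain ⟨w, hw, hwd⟩ := hP (d s)
    have hinv : (w : L)⁻¹ ∈ P.O := P.isUnit' w (by rw [hwd]; exact haD s hs)
    have hdO : d s • s ∈ P.O := by
      have hle : (algebraMap K[X] L).range ≤ P.O.toSubring := by
        rintro _ ⟨p, rfl⟩
        obtain ⟨w, hw, -⟩ := hP p
        have : (algebraMap K[X] L p) = w := hw.symm
        rw [this]
        exact w.2
      let φ : K[X] →+* P.O := (algebraMap K[X] L).codRestrict P.O.toSubring fun p => hle ⟨p, rfl⟩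
      have : IsIntegral P.O (d s • s) := by
        letI := φ.toAlgebra
        haveI : IsScalarTower K[X] P.O L := IsScalarTower.of_algebraMap_eq fun _ => rfl
        exact (hdi s).tower_top
      obtain ⟨z, hz⟩ := IsIntegrallyClosed.isIntegral_iff.mp this
      rw [← hz]
      exact z.2
    have hw0 : (w : L) ≠ 0 := by
      rw [hw]
      simpa using hd s
    have : s = (w : L)⁻¹ * (d s • s) := by
      rw [Algebra.smul_def, ← mul_assoc]
      have : (algebraMap K[X] L (d s)) = w := hw.symm
      rw [this, inv_mul_cancel₀ hw0, one_mul]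
    rw [this]
    exact mul_mem hinv hdO

theorem trdeg_drop {k : Type*} {A F : Type w} [Field k] [CommRing A] [IsDomain A] [Field F]
    [Algebra k A] [Algebra k F] (r : A →ₐ[k] F) (hr : Function.Surjective r) (ϖ : A) (h0 : ϖ ≠ 0)
    (h1 : r ϖ = 0) : Algebra.trdeg k F + 1 ≤ Algebra.trdeg k A := by
  obtain ⟨s, hs⟩ := exists_isTranscendenceBasis k F
  choose g hg using hr
  let y : s → A := fun i => g i
  have hry : r ∘ y = ((↑) : s → F) := funext fun i => hg i
  have hy : AlgebraicIndependent k y := by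
    apply AlgebraicIndependent.of_comp r
    rw [hry]
    exact hs.1
  have hinj : ∀ z ∈ Algebra.adjoin k (Set.range y), r z = 0 → z = 0 := by
    intro z hz hz0
    rw [Algebra.adjoin_range_eq_range_aeval] at hz
    obtain ⟨m, rfl⟩ := hz
    have : MvPolynomial.aeval ((↑) : s → F) m = 0 := by
      rw [← hry, ← hz0]
      exact (MvPolynomial.comp_aeval_apply y r m).symm
    have hm : m = 0 := hs.1 (by rw [this, map_zero])
    rw [hm]
    exact map_zero (MvPolynomial.aeval y)
  have htr : Transcendental (Algebra.adjoin k (Set.range y)) ϖ := by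
    rw [transcendental_iff]
    have key : ∀ (n : ℕ) (p : (Algebra.adjoin k (Set.range y))[X]), p.natDegree ≤ n →
        aeval ϖ p = 0 → p = 0 := by
      intro n
      induction n with
      | zero =>
        intro p hp hp0
        rw [eq_C_of_natDegree_eq_zero (Nat.le_zero.mp hp), aeval_C] at hp0
        rw [eq_C_of_natDegree_eq_zero (Nat.le_zero.mp hp), (Subtype.ext hp0 : p.coeff 0 = 0), C_0]
      | succ n ih =>
        intro p hp hp0
        have e := divX_mul_X_add p
        have hp1 := hp0
        rw [← e, map_add, map_mul, aeval_X, aeval_C] at hp1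
        have hc : p.coeff 0 = 0 := by
          apply Subtype.ext
          apply hinj _ (p.coeff 0).2
          have := congrArg r hp1
          rw [map_add, map_mul, h1, mul_zero, zero_add, map_zero] at this
          exact this
        rw [hc, map_zero, add_zero] at hp1
        have hd := ih p.divX (by rw [natDegree_divX_eq_natDegree_tsub_one]; omega)
          ((mul_eq_zero.mp hp1).resolve_right h0)
        rw [← e, hd, hc]; simp
    exact fun p hp => key _ p le_rfl hp
  have hopt := (hy.option_iff_transcendental ϖ).mpr htr
  have hle := hopt.cardinalMk_le_trdeg
  rw [Cardinal.mk_option, hs.cardinalMk_eq_trdeg] at hle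
  exact hle

namespace Plc

variable {k L Ω : Type*} [Field k] [Field L] [Field Ω] [Algebra k L] [Algebra k Ω]

/-- The place is trivial on `k`. -/
def Over (k : Type*) {L Ω : Type*} [Field k] [Field L] [Field Ω] [Algebra k L] [Algebra k Ω]
    (P : Plc L Ω) : Prop :=
  ∀ c : k, ∃ w : P.O, (w : L) = algebraMap k L c ∧ P.ρ w = algebraMap k Ω c

/-- The residue field of a subfield. -/
def res (P : Plc L Ω) (hP : P.Over k) (F : IntermediateField k L) : IntermediateField k Ω where
  carrier := {z | ∃ w : P.O, (w : L) ∈ F ∧ P.ρ w = z}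
  mul_mem' := by
    rintro _ _ ⟨w, hw, rfl⟩ ⟨v, hv, rfl⟩
    exact ⟨w * v, mul_mem hw hv, map_mul _ _ _⟩
  add_mem' := by
    rintro _ _ ⟨w, hw, rfl⟩ ⟨v, hv, rfl⟩
    exact ⟨w + v, add_mem hw hv, map_add _ _ _⟩
  algebraMap_mem' := by
    intro c
    obtain ⟨w, hw, h⟩ := hP c
    exact ⟨w, hw ▸ F.algebraMap_mem c, h⟩
  inv_mem' := by
    rintro _ ⟨w, hw, rfl⟩
    by_cases h0 : P.ρ w = 0
    · rw [h0, inv_zero]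
      exact ⟨0, zero_mem F, map_zero _⟩
    · have hw0 : w ≠ 0 := by
        rintro rfl
        exact h0 (map_zero _)
      refine ⟨⟨(w : L)⁻¹, P.isUnit' w h0⟩, inv_mem hw, ?_⟩
      apply eq_inv_of_mul_eq_one_left
      rw [← map_mul, ← map_one P.ρ]
      congr 1
      apply Subtype.ext
      exact inv_mul_cancel₀ (fun h => hw0 (Subtype.ext h))

theorem mem_res {P : Plc L Ω} {hP : P.Over k} {F : IntermediateField k L} {z : Ω} :
    z ∈ P.res hP F ↔ ∃ w : P.O, (w : L) ∈ F ∧ P.ρ w = z := Iff.rfl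

/-- The valuation ring of a subfield. -/
def sub (P : Plc L Ω) (hP : P.Over k) (F : IntermediateField k L) : Subalgebra k F where
  carrier := {z | (z : L) ∈ P.O}
  mul_mem' := fun h1 h2 => P.O.mul_mem _ _ h1 h2
  add_mem' := fun h1 h2 => P.O.add_mem _ _ h1 h2
  algebraMap_mem' := by
    intro c
    obtain ⟨w, hw, h⟩ := hP c
    change algebraMap k L c ∈ P.O
    rw [← hw]
    exact w.2

theorem mem_sub {P : Plc L Ω} {hP : P.Over k} {F : IntermediateField k L} {z : F} :
    z ∈ P.sub hP F ↔ (z : L) ∈ P.O := Iff.rfl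

/-- Inclusion of the valuation ring of the subfield. -/
def incl (P : Plc L Ω) (hP : P.Over k) (F : IntermediateField k L) : P.sub hP F →+* P.O where
  toFun z := ⟨z.1.1, z.2⟩
  map_one' := rfl
  map_mul' _ _ := rfl
  map_zero' := rfl
  map_add' _ _ := rfl

/-- The residue map. -/
def rd (P : Plc L Ω) (hP : P.Over k) (F : IntermediateField k L) :
    P.sub hP F →ₐ[k] P.res hP F where
  toFun z := ⟨P.ρ (P.incl hP F z), ⟨_, z.1.2, rfl⟩⟩
  map_one' := Subtype.ext (by simp)
  map_mul' _ _ := Subtype.ext (by simp)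
  map_zero' := Subtype.ext (by simp)
  map_add' _ _ := Subtype.ext (by simp)
  commutes' c := by
    obtain ⟨w, hw, h⟩ := hP c
    apply Subtype.ext
    refine Eq.trans ?_ h
    change P.ρ _ = P.ρ w
    congr 1
    exact Subtype.ext hw.symm

theorem rd_surjective (P : Plc L Ω) (hP : P.Over k) (F : IntermediateField k L) :
    Function.Surjective (P.rd hP F) := by
  rintro ⟨_, ⟨w, hw, rfl⟩⟩
  exact ⟨⟨⟨w, hw⟩, w.2⟩, rfl⟩

theorem trdeg_res {k : Type u} {L Ω : Type v} [Field k] [Field L] [Field Ω] [Algebra k L]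
    [Algebra k Ω] (P : Plc L Ω) (hP : P.Over k) (F : IntermediateField k L) (ϖ : P.O)
    (h : (ϖ : L) ∈ F) (h0 : ϖ ≠ 0) (h1 : P.ρ ϖ = 0) :
    Algebra.trdeg k (P.res hP F) + 1 ≤ Algebra.trdeg k F := by
  refine (trdeg_drop (P.rd hP F) (P.rd_surjective hP F) ⟨⟨ϖ, h⟩, ϖ.2⟩ ?_ ?_).trans ?_
  · intro h
    apply h0
    have := congrArg (fun z : P.sub hP F => (z : L)) h
    exact Subtype.ext this
  · exact Subtype.ext h1
  · exact trdeg_le_of_injective (P.sub hP F).val Subtype.val_injective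

theorem scale (P : Plc L Ω) (hP : P.Over k) (F : IntermediateField k L) {ι : Type*} [Fintype ι]
    (p : ι → F[X]) (hp : ∃ i, p i ≠ 0) :
    ∃ (q : ι → (P.sub hP F)[X]) (b : F), b ≠ 0 ∧
      (∀ i, (q i).map (algebraMap (P.sub hP F) F) = C b * p i) ∧
      ∃ i, (q i).map (P.rd hP F : P.sub hP F →+* P.res hP F) ≠ 0 := by
  classical
  let T : Finset F := Finset.univ.biUnion fun i => (p i).coeffs
  have hT : T.Nonempty := by
    obtain ⟨i, hi⟩ := hp
    refine ⟨(p i).leadingCoeff, Finset.mem_biUnion.mpr ⟨i, Finset.mem_univ _, ?_⟩⟩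
    exact coeff_mem_coeffs (leadingCoeff_ne_zero.mpr hi)
  obtain ⟨c, hc, hmax⟩ := Finset.exists_max_image T (fun c => P.O.valuation (c : L)) hT
  obtain ⟨i0, -, hi0⟩ := Finset.mem_biUnion.mp hc
  obtain ⟨j0, hj0, hcj⟩ := mem_coeffs_iff.mp hi0
  have hc0 : c ≠ 0 := hcj ▸ mem_support_iff.mp hj0
  have hv0 : P.O.valuation (c : L) ≠ 0 := by
    rw [Valuation.ne_zero_iff]
    exact fun h => hc0 (Subtype.ext h)
  have hlift : ∀ i, ∃ q : (P.sub hP F)[X],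
      q.map (algebraMap (P.sub hP F) F) = C c⁻¹ * p i := by
    intro i
    rw [← mem_lifts, lifts_iff_coeff_lifts]
    intro j
    rw [coeff_C_mul]
    refine ⟨⟨c⁻¹ * (p i).coeff j, ?_⟩, rfl⟩
    rw [mem_sub]
    by_cases h : (p i).coeff j = 0
    · rw [h, mul_zero]; exact zero_mem _
    · have := hmax _ (Finset.mem_biUnion.mpr ⟨i, Finset.mem_univ _, coeff_mem_coeffs h⟩)
      rw [← P.O.valuation_le_one_iff]
      change P.O.valuation ((c : L)⁻¹ * ((p i).coeff j : L)) ≤ 1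
      rw [map_mul, map_inv₀]
      exact inv_mul_le_one_of_le₀ this zero_le
  choose q hq using hlift
  refine ⟨q, c⁻¹, inv_ne_zero hc0, hq, i0, fun h => ?_⟩
  have h1 : (q i0).coeff j0 = 1 := by
    apply Subtype.val_injective
    have := congrArg (fun p => p.coeff j0) (hq i0)
    simp only [coeff_map, coeff_C_mul] at this
    rw [← hcj, inv_mul_cancel₀ hc0] at this
    exact this
  have := congrArg (fun p => p.coeff j0) h
  simp only [coeff_map, h1, map_one, coeff_zero] at this
  exact one_ne_zero this

theorem eval_compat (P : Plc L Ω) (hP : P.Over k) (F : IntermediateField k L) (t : P.O)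
    (q : (P.sub hP F)[X]) :
    ∃ z : P.O, (z : L) = aeval (t : L) (q.map (algebraMap (P.sub hP F) F)) ∧
      P.ρ z = aeval (P.ρ t) (q.map (P.rd hP F : P.sub hP F →+* P.res hP F)) := by
  refine ⟨eval₂ (P.incl hP F) t q, ?_, ?_⟩
  · rw [aeval_def, eval₂_map]
    change P.O.subtype _ = _
    rw [hom_eval₂]
    rfl
  · rw [aeval_def, eval₂_map, hom_eval₂]
    rfl

theorem dependent (P : Plc L Ω) (hP : P.Over k) (F : IntermediateField k L) (t : P.O) {n : ℕ}
    (H : ∀ w : Fin n → L, ∃ p : Fin n → F[X], (∃ i, p i ≠ 0) ∧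
      ∑ i, aeval (t : L) (p i) * w i = 0) (w : Fin n → P.O) :
    ∃ p : Fin n → (P.res hP F)[X], (∃ i, p i ≠ 0) ∧
      ∑ i, aeval (P.ρ t) (p i) * P.ρ (w i) = 0 := by
  obtain ⟨p, hp, hs⟩ := H fun i => w i
  obtain ⟨q, b, hb, hq, hq0⟩ := P.scale hP F p hp
  refine ⟨_, hq0, ?_⟩
  choose z hz hzρ using fun i => P.eval_compat hP F t (q i)
  have : ∑ i, z i * w i = 0 := by
    apply Subtype.ext
    have : ((∑ i, z i * w i : P.O) : L) = ∑ i, (z i : L) * w i := by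
      change P.O.subtype _ = _
      rw [map_sum]; rfl
    rw [this]
    have h2 : ∀ i, (z i : L) * w i = b * (aeval (t : L) (p i) * w i) := fun i => by
      rw [hz, hq, map_mul, aeval_C, mul_assoc]; rfl
    rw [Finset.sum_congr rfl fun i _ => h2 i, ← Finset.mul_sum, hs, mul_zero]; rfl
  have := congrArg P.ρ this
  rw [map_sum, map_zero] at this
  rw [← this]
  exact Finset.sum_congr rfl fun i _ => by rw [map_mul, hzρ]

end Plc

theorem aeval_mem_E {M Ω : Type*} [Field M] [Field Ω] [Algebra M Ω] (E : IntermediateField M Ω)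
    {z : Ω} (hz : z ∈ E) (p : M[X]) : aeval z p ∈ E := by
  have : aeval z p = ((aeval (⟨z, hz⟩ : E) p : E) : Ω) :=
    aeval_algebraMap_apply Ω (⟨z, hz⟩ : E) p
  rw [this]
  exact Subtype.property _

theorem exists_S {k L : Type*} (Ω : Type*) [Field k] [Field L] [Field Ω] [Algebra k L] [Algebra k Ω]
    (F : IntermediateField k L) (t : L) (ht : Transcendental F t) {n : ℕ}
    (H : ∀ w : Fin n → L, ∃ p : Fin n → F[X], (∃ i, p i ≠ 0) ∧
      ∑ i, aeval t (p i) * w i = 0) (g : L) :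
    ∃ S : Finset L, ∀ (P : Plc L Ω) (hP : P.Over k), (∀ s ∈ S, s ∈ P.O) → ∀ (t' g' : P.O),
      (t' : L) = t → (g' : L) = g → IsAlgebraic (P.res hP F) (P.ρ t') →
      IsAlgebraic (P.res hP F) (P.ρ g') := by
  classical
  obtain ⟨p, ⟨i0, hi0⟩, hs⟩ := H fun i => g ^ (i : ℕ)
  have hne : aeval t (p i0) ≠ 0 := fun h => hi0 ((transcendental_iff.mp ht) _ h)
  refine ⟨insert (aeval t (p i0))⁻¹ (Finset.univ.biUnion fun i => (p i).coeffs.image (fun c : F => (c : L))),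
    fun P hP hS t' g' ht' hg' halg => ?_⟩
  have hlift : ∀ i, ∃ q : (P.sub hP F)[X],
      q.map (algebraMap (P.sub hP F) F) = p i := by
    intro i
    rw [← mem_lifts, lifts_iff_coeff_lifts]
    intro j
    refine ⟨⟨(p i).coeff j, ?_⟩, rfl⟩
    rw [Plc.mem_sub]
    by_cases h : (p i).coeff j = 0
    · rw [h]; exact zero_mem _
    · exact hS _ (Finset.mem_insert_of_mem (Finset.mem_biUnion.mpr ⟨i, Finset.mem_univ _,
        Finset.mem_image_of_mem _ (coeff_mem_coeffs h)⟩))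
  choose q hq using hlift
  choose z hz hzρ using fun i => P.eval_compat hP F t' (q i)
  let E := algebraicClosure (P.res hP F) Ω
  have htE : P.ρ t' ∈ E := mem_algebraicClosure_iff.mpr halg
  have hzE : ∀ i, P.ρ (z i) ∈ E := fun i => by
    rw [hzρ]
    exact aeval_mem_E E htE _
  let zE : Fin n → E := fun i => ⟨P.ρ (z i), hzE i⟩
  let Q : E[X] := ∑ i : Fin n, monomial (i : ℕ) (zE i)
  have hQ : Q.coeff i0 = zE i0 := by
    simp only [Q, finsetSum_coeff, coeff_monomial]
    rw [Finset.sum_eq_single i0]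
    · simp
    · intro b _ hb
      rw [if_neg]
      exact fun h => hb (Fin.ext h)
    · simp
  have hzne : P.ρ (z i0) ≠ 0 := by
    intro h
    have h1 : (aeval t (p i0))⁻¹ ∈ P.O := hS _ (Finset.mem_insert_self _ _)
    have h2 : z i0 * ⟨_, h1⟩ = 1 := by
      apply Subtype.ext
      change (z i0 : L) * (aeval t (p i0))⁻¹ = 1
      rw [hz, hq, ht', mul_inv_cancel₀ hne]
    have := congrArg P.ρ h2
    rw [map_mul, h, zero_mul, map_one] at this
    exact zero_ne_one this
  have hgE : IsAlgebraic E (P.ρ g') := by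
    refine ⟨Q, ?_, ?_⟩
    · intro h
      rw [h, coeff_zero] at hQ
      exact hzne (congrArg Subtype.val hQ.symm)
    · have h0 : ∑ i, z i * g' ^ (i : ℕ) = 0 := by
        apply Subtype.ext
        have : ((∑ i, z i * g' ^ (i : ℕ) : P.O) : L) = ∑ i, (z i : L) * (g' : L) ^ (i : ℕ) := by
          change P.O.subtype _ = _
          rw [map_sum]; rfl
        rw [this, hg']
        refine Eq.trans (Finset.sum_congr rfl fun i _ => ?_) hs
        rw [hz, hq, ht']
      have := congrArg P.ρ h0
      rw [map_sum, map_zero] at this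
      rw [← this, map_sum]
      refine Finset.sum_congr rfl fun i _ => ?_
      rw [aeval_monomial, map_mul, map_pow]; rfl
  exact hgE.restrictScalars (P.res hP F)

theorem trdeg_ratFunc_alg {k : Type u} {K : Type v} {L : Type w} [Field k] [Field K] [Field L]
    [Algebra k K] [Algebra k L] [Algebra (RatFunc K) L] [Algebra.IsAlgebraic (RatFunc K) L]
    (hc : ∀ c : k, algebraMap k L c = algebraMap (RatFunc K) L (RatFunc.C (algebraMap k K c))) :
    Cardinal.lift.{v} (Algebra.trdeg k L) = Cardinal.lift.{w} (Algebra.trdeg k K) + 1 := by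
  haveI : IsScalarTower k (RatFunc K) L := IsScalarTower.of_algebraMap_eq hc
  have h1 := lift_trdeg_add_eq (R := k) (S := RatFunc K) (A := L)
  have h2 := trdeg_add_eq (R := k) (S := K) (A := RatFunc K)
  have h3 : Algebra.trdeg K (RatFunc K) = 1 := by
    have hX := trdeg_add_eq (R := K) (S := K[X]) (A := RatFunc K)
    rw [Polynomial.trdeg_of_isDomain] at hX
    haveI : Algebra.IsAlgebraic K[X] (RatFunc K) :=
      ⟨fun x => (IsFractionRing.isAlgebraic_iff K[X] (RatFunc K) (RatFunc K)).mpr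
        (isAlgebraic_algebraMap (R := RatFunc K) x)⟩
    rw [trdeg_eq_zero (R := K[X]) (A := RatFunc K), add_zero] at hX
    exact hX.symm
  rw [trdeg_eq_zero (R := RatFunc K) (A := L), Cardinal.lift_zero, add_zero] at h1
  rw [← h1, ← h2, h3]
  simp

theorem trdeg_le_of_alg {k : Type u} {K : Type v} {Ω : Type w} (M : Type w) [Field k] [Field K]
    [Field M] [Field Ω] [Algebra k K] [Algebra k Ω] [Algebra K Ω] [IsScalarTower k K Ω]
    [Algebra k M] [Algebra M Ω] [IsScalarTower k M Ω]
    (halg : ∀ c : K, IsAlgebraic M (algebraMap K Ω c)) :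
    Cardinal.lift.{w} (Algebra.trdeg k K) ≤ Cardinal.lift.{v} (Algebra.trdeg k M) := by
  let E := algebraicClosure M Ω
  haveI : Algebra.IsAlgebraic M E := inferInstance
  haveI : IsScalarTower k M E := inferInstance
  haveI : FaithfulSMul M E := inferInstance
  have e5 := trdeg_add_eq (R := k) (S := M) (A := E)
  rw [trdeg_eq_zero (R := M) (A := E), add_zero] at e5
  let φ : K →ₐ[k] E := (IsScalarTower.toAlgHom k K Ω).codRestrict (E.toSubalgebra.restrictScalars k)
    fun c => mem_algebraicClosure_iff.mpr (halg c)
  have e6 := lift_trdeg_le_of_injective φ φ.toRingHom.injective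
  rw [← e5] at e6
  exact e6

theorem transc_contra {k : Type u} {K : Type v} {L Ω : Type w} [Field k] [Field K] [Field L]
    [Field Ω] [Algebra k K] [Algebra k L] [Algebra k Ω] [Algebra K Ω] [IsScalarTower k K Ω]
    [Algebra (RatFunc K) L] [Algebra.IsAlgebraic (RatFunc K) L]
    (hc : ∀ c : k, algebraMap k L c = algebraMap (RatFunc K) L (RatFunc.C (algebraMap k K c)))
    (hK : Algebra.trdeg k K < Cardinal.aleph0)
    (P : Plc L Ω) (hP : P.Over k) (F : IntermediateField k L) (t : L) (ht : Transcendental F t)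
    (ϖ : P.O) (h : (ϖ : L) ∈ F) (h0 : ϖ ≠ 0) (h1 : P.ρ ϖ = 0)
    (halg : ∀ c : K, IsAlgebraic (P.res hP F) (algebraMap K Ω c)) : False := by
  have e1 := P.trdeg_res hP F ϖ h h0 h1
  have e2 := trdeg_add_eq (R := k) (S := F) (A := L)
  haveI : Algebra.Transcendental F L := ⟨t, ht⟩
  have e3 : 1 ≤ Algebra.trdeg F L := Cardinal.one_le_iff_pos.mpr (trdeg_pos F L)
  have e4 := trdeg_ratFunc_alg (L := L) hc
  have e6 := trdeg_le_of_alg (k := k) (P.res hP F) halg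
  have hL : Algebra.trdeg k L < Cardinal.aleph0 := by
    rw [← Cardinal.lift_lt_aleph0, e4]
    exact Cardinal.add_lt_aleph0 (Cardinal.lift_lt_aleph0.mpr hK) Cardinal.one_lt_aleph0
  have f1 : Algebra.trdeg k (P.res hP F) + 1 + 1 ≤ Algebra.trdeg k L := by
    rw [← e2]
    exact add_le_add e1 e3
  have f2 : Algebra.trdeg k (P.res hP F) < Cardinal.aleph0 := 
    lt_of_le_of_lt ((self_le_add_right _ _).trans ((self_le_add_right _ _).trans f1)) hL
  have f3 : Cardinal.lift.{v} (Algebra.trdeg k (P.res hP F) + 1 + 1) ≤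
      Cardinal.lift.{v} (Algebra.trdeg k (P.res hP F)) + 1 := by
    refine (Cardinal.lift_le.mpr f1).trans ?_
    rw [e4]
    gcongr
  obtain ⟨N, hN⟩ := Cardinal.lt_aleph0.mp f2
  rw [hN] at f3
  simp only [Cardinal.lift_add, Cardinal.lift_natCast, Cardinal.lift_one] at f3
  have : N + 1 + 1 ≤ N + 1 := by exact_mod_cast f3
  omega

theorem fg_aux {F E L : Type*} [Field F] [Field E] [Field L] [Algebra F E] [Algebra E L]
    [Algebra F L] [IsScalarTower F E L] [Algebra.IsAlgebraic F E] [Algebra.EssFiniteType F L]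
    (t : L) (ht : Transcendental E t)
    (hfin : letI := (liftT t ht).toRingHom.toAlgebra; Algebra.IsAlgebraic (RatFunc E) L) :
    FiniteDimensional F E := by
  have htF : Transcendental F t := Transcendental.of_tower_top F ht
  letI := (liftT t htF).toRingHom.toAlgebra
  have hC : ∀ c : F, algebraMap (RatFunc F) L (RatFunc.C c) = algebraMap F L c := liftT_C t htF
  haveI : IsScalarTower F (RatFunc F) L := IsScalarTower.of_algebraMap_eq fun c => (hC c).symm
  haveI : Algebra.EssFiniteType (RatFunc F) L := Algebra.EssFiniteType.of_comp F (RatFunc F) L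
  let A := algebraicClosure (RatFunc F) L
  have hEA : ∀ c : E, algebraMap E L c ∈ A := fun c => by
    rw [mem_algebraicClosure_iff]
    have : IsAlgebraic F (algebraMap E L c) :=
      (Algebra.IsAlgebraic.isAlgebraic c).algebraMap
    exact this.tower_top _
  have htA : t ∈ A := by
    have : t = algebraMap (RatFunc F) L RatFunc.X := (liftT_X t htF).symm
    rw [this]
    exact A.algebraMap_mem _
  have hrange : ∀ z : RatFunc E, liftT t ht z ∈ A := fun z => by
    have := ratFunc_mem (A.toSubfield.comap (liftT t ht).toRingHom) (fun c => by
      change liftT t ht _ ∈ A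
      rw [liftT_C]; exact hEA c) (by
      change liftT t ht _ ∈ A
      rw [liftT_X]; exact htA) z
    exact this
  haveI : Algebra.IsAlgebraic (RatFunc F) L := by
    constructor
    intro l
    have hl : IsAlgebraic A l := by
      obtain ⟨p, hp, hp0⟩ := hfin.isAlgebraic l
      let φ : RatFunc E →+* A := (liftT t ht).toRingHom.codRestrict A hrange
      refine ⟨p.map φ, (Polynomial.map_ne_zero_iff φ.injective).mpr hp, ?_⟩
      rw [aeval_def, eval₂_map]
      exact hp0
    exact hl.restrictScalars _
  haveI : FiniteDimensional (RatFunc F) L := by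
    obtain ⟨S, hS⟩ := IntermediateField.fg_top (F := RatFunc F) (E := L)
    have : FiniteDimensional (RatFunc F) (IntermediateField.adjoin (RatFunc F) (S : Set L)) :=
      IntermediateField.finiteDimensional_adjoin fun x _ => Algebra.IsIntegral.isIntegral x
    rw [hS] at this
    exact Module.Finite.equiv (IntermediateField.topEquiv (F := RatFunc F) (E := L)).toLinearEquiv
  let b := Module.Basis.ofVectorSpace F E
  have hlin : LinearIndependent (RatFunc F) (fun i => algebraMap E L (b i)) := by
    letI : Algebra F[X] L :=
      ((algebraMap (RatFunc F) L).comp (algebraMap F[X] (RatFunc F))).toAlgebra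
    haveI : IsScalarTower F[X] (RatFunc F) L := IsScalarTower.of_algebraMap_eq fun _ => rfl
    rw [← LinearIndependent.iff_fractionRing F[X] (RatFunc F), linearIndependent_iff']
    intro s g hg i hi
    have h1 : ∑ i ∈ s, (g i).map (algebraMap F E) * C (b i) = 0 := by
      apply transcendental_iff.mp ht
      rw [map_sum, ← hg]
      refine Finset.sum_congr rfl fun i _ => ?_
      rw [map_mul, aeval_C, aeval_map_algebraMap, Algebra.smul_def]
      congr 1
      exact (liftT_algebraMap t htF _).symm
    ext j
    have hw := b.linearIndependent
    rw [linearIndependent_iff'] at hw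
    refine hw s (fun i => (g i).coeff j) ?_ i hi
    have := congrArg (fun p => p.coeff j) h1
    simpa [Polynomial.finsetSum_coeff, Algebra.smul_def] using this
  haveI := hlin.finite
  exact Module.Finite.of_basis b

theorem fg_of {k E L : Type*} [Field k] [Field E] [Field L] [Algebra k E] [Algebra E L]
    [Algebra k L] [IsScalarTower k E L] [Algebra.EssFiniteType k L]
    (t : L) (ht : Transcendental E t)
    (hfin : letI := (liftT t ht).toRingHom.toAlgebra; Algebra.IsAlgebraic (RatFunc E) L) :
    Algebra.EssFiniteType k E := by
  have htr : Algebra.trdeg k E < Cardinal.aleph0 := by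
    rw [← Cardinal.lift_lt_aleph0]
    exact (lift_trdeg_le_of_injective (IsScalarTower.toAlgHom k E L)
      (algebraMap E L).injective).trans_lt (Cardinal.lift_lt_aleph0.mpr (trdeg_lt_aleph0 k L))
  obtain ⟨F, hF, halg⟩ := (finTrdeg_iff_trdeg.mpr htr).exists_fg_isAlgebraic
  haveI : Algebra.EssFiniteType k F := IntermediateField.essFiniteType_iff.mpr hF
  haveI : Algebra.EssFiniteType F L := Algebra.EssFiniteType.of_comp k F L
  haveI : FiniteDimensional F E := fg_aux t ht hfin
  exact Algebra.EssFiniteType.comp k F E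

/-- Output of the specialization, in terms of a field `KB` and `K`-field `KC`. -/
theorem finish {k : Type u} {K : Type v} (KB KC : Type (max u v)) [Field k] [Field K] [Field KB]
    [Field KC] [Algebra k K] [Algebra k KB] [Algebra KB KC] [Algebra k KC] [Algebra K KC]
    [IsScalarTower k K KC] [IsScalarTower k KB KC] [Algebra.EssFiniteType k K]
    [FiniteDimensional K KC] [Algebra.IsSeparable K KC] (t : KC) (ht : Transcendental KB t)
    {e : ℕ} (H : ∀ w : Fin (e + 1) → KC, ∃ p : Fin (e + 1) → KB[X], (∃ i, p i ≠ 0) ∧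
      ∑ i, aeval t (p i) * w i = 0) :
    ∃ e', 0 < e' ∧ e' ≤ e ∧ HasSepCvgDiagram k K e' := by
  haveI : Algebra.EssFiniteType k KC := Algebra.EssFiniteType.comp k K KC
  let π : RatFunc KB →ₐ[k] KC :=
    { (liftT t ht).toRingHom with
      commutes' := fun c => by
        change liftT t ht (algebraMap k (RatFunc KB) c) = _
        rw [IsScalarTower.algebraMap_apply k KB (RatFunc KB), RatFunc.algebraMap_eq_C, liftT_C,
          ← IsScalarTower.algebraMap_apply] }
  letI := π.toRingHom.toAlgebra
  have hrank : Module.rank (RatFunc KB) KC ≤ e := by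
    apply rank_le
    intro s hs
    by_contra hcard
    rw [not_le] at hcard
    let g : Fin (e + 1) → s := fun i => s.equivFin.symm (Fin.castLE hcard i)
    have hg : Function.Injective g :=
      s.equivFin.symm.injective.comp (Fin.castLE_injective hcard)
    have hli := hs.comp g hg
    obtain ⟨p, ⟨i, hi⟩, hp⟩ := H fun i => (g i : KC)
    rw [Fintype.linearIndependent_iff] at hli
    have := hli (fun i => algebraMap KB[X] (RatFunc KB) (p i)) (by
      rw [← hp]
      refine Finset.sum_congr rfl fun i _ => ?_
      rw [Algebra.smul_def]
      congr 1
      exact liftT_algebraMap t ht (p i)) i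
    exact hi (by simpa using this)
  haveI : Module.Finite (RatFunc KB) KC :=
    Module.rank_lt_aleph0_iff.mp (hrank.trans_lt (Cardinal.natCast_lt_aleph0))
  refine ⟨Module.finrank (RatFunc KB) KC, Module.finrank_pos, Module.finrank_le_of_rank_le hrank, 
    KB, KC, inferInstance, inferInstance, inferInstance, inferInstance,
    IntermediateField.fg_top_iff.mpr (fg_of t ht ?_), IntermediateField.fg_top_iff.mpr inferInstance,
    IsScalarTower.toAlgHom k K KC, π, ?_, ?_, rfl⟩
  · exact (inferInstance : Algebra.IsAlgebraic (RatFunc KB) KC)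
  · exact RingHom.finite_algebraMap.mpr inferInstance
  · have : (IsScalarTower.toAlgHom k K KC).toRingHom.toAlgebra = ‹Algebra K KC› :=
      Algebra.algebra_ext _ _ fun _ => rfl
    rw [this]
    infer_instance

theorem core {k : Type u} {K : Type v} {L Ω : Type (max u v)} [Field k] [Field K] [Field L]
    [Field Ω] [Algebra k K] [Algebra k L] [Algebra K L] [IsScalarTower k K L] [Algebra k Ω]
    [Algebra K Ω] [IsScalarTower k K Ω] [IsAlgClosed Ω] [Algebra (RatFunc K) L]
    [FiniteDimensional (RatFunc K) L] [Algebra.IsSeparable (RatFunc K) L]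
    [Algebra.EssFiniteType k K]
    (hcK : ∀ c : K, algebraMap K L c = algebraMap (RatFunc K) L (RatFunc.C c))
    (F : IntermediateField k L) (hx : algebraMap (RatFunc K) L RatFunc.X ∈ F) (t : L)
    (ht : Transcendental F t) {e : ℕ}
    (H : ∀ w : Fin (e + 1) → L, ∃ p : Fin (e + 1) → F[X], (∃ i, p i ≠ 0) ∧
      ∑ i, aeval t (p i) * w i = 0) :
    ∃ e', 0 < e' ∧ e' ≤ e ∧ HasSepCvgDiagram k K e' := by
  classical
  have hc : ∀ c : k, algebraMap k L c = algebraMap (RatFunc K) L (RatFunc.C (algebraMap k K c)) :=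
    fun c => by rw [← hcK, ← IsScalarTower.algebraMap_apply]
  obtain ⟨G, hG⟩ := IntermediateField.fg_top (F := k) (E := K)
  choose S hS using fun g : L => exists_S Ω F t ht H g
  obtain ⟨P, K', a, hfin, hsep, ha, hK', hpoly, hSP⟩ := exists_place k (K := K) (Ω := Ω)
    (insert t (G.biUnion fun g => S (algebraMap K L g)))
  have hPK : P.Over K := fun c => by
    obtain ⟨w, hw, hρ⟩ := hpoly (C c)
    refine ⟨w, ?_, ?_⟩
    · rw [hw, hcK, RatFunc.algebraMap_C]
    · rw [hρ, aeval_C]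
  have hP : P.Over k := fun c => by
    obtain ⟨w, hw, hρ⟩ := hPK (algebraMap k K c)
    refine ⟨w, ?_, ?_⟩
    · rw [hw, ← IsScalarTower.algebraMap_apply]
    · rw [hρ, ← IsScalarTower.algebraMap_apply]
  let t' : P.O := ⟨t, hSP t (Finset.mem_insert_self _ _)⟩
  -- the uniformizer
  obtain ⟨ϖ, hϖ, hϖρ⟩ := hpoly ((minpoly k a).map (algebraMap k K))
  have hϖ1 : P.ρ ϖ = 0 := by rw [hϖρ, aeval_map_algebraMap, minpoly.aeval]
  have hϖ0 : ϖ ≠ 0 := by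
    intro h
    rw [h] at hϖ
    have h0 : (minpoly k a).map (algebraMap k K) ≠ 0 :=
      (Polynomial.map_ne_zero_iff (algebraMap k K).injective).mpr
        (minpoly.ne_zero ha.isIntegral)
    have h1 : algebraMap K[X] (RatFunc K) ((minpoly k a).map (algebraMap k K)) ≠ 0 := by
      simpa using h0
    exact (map_ne_zero (algebraMap (RatFunc K) L)).mpr h1 hϖ.symm
  have hϖF : (ϖ : L) ∈ F := by
    rw [hϖ]
    have : ((algebraMap (RatFunc K) L).comp (algebraMap K[X] (RatFunc K))).comp
        (mapRingHom (algebraMap k K)) =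
        (aeval (algebraMap (RatFunc K) L RatFunc.X) : k[X] →ₐ[k] L).toRingHom := by
      apply Polynomial.ringHom_ext
      · intro c
        simp [hc]
      · simp
    have h2 := RingHom.congr_fun this (minpoly k a)
    have h3 : algebraMap (RatFunc K) L (algebraMap K[X] (RatFunc K)
        ((minpoly k a).map (algebraMap k K))) =
        aeval (algebraMap (RatFunc K) L RatFunc.X) (minpoly k a) := h2
    rw [h3]
    exact aeval_mem_E F hx _
  have htt : Transcendental (P.res hP F) (P.ρ t') := by
    intro halg
    refine transc_contra (K := K) hc (trdeg_lt_aleph0 k K) P hP F t ht ϖ hϖF hϖ0 hϖ1 ?_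
    let A : IntermediateField k Ω := (algebraicClosure (P.res hP F) Ω).restrictScalars k
    have hle : IntermediateField.adjoin k (G : Set K) ≤ A.comap (IsScalarTower.toAlgHom k K Ω) := by
      rw [IntermediateField.adjoin_le_iff]
      intro g hg
      obtain ⟨w, hw, hρ⟩ := hPK g
      have := hS (algebraMap K L g) P hP (fun s hs => hSP s (Finset.mem_insert_of_mem
        (Finset.mem_biUnion.mpr ⟨g, hg, hs⟩))) t' w rfl hw halg
      rw [hρ] at this
      exact mem_algebraicClosure_iff.mpr this
    intro c
    have : c ∈ A.comap (IsScalarTower.toAlgHom k K Ω) := hle (by rw [hG]; trivial)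
    exact mem_algebraicClosure_iff.mp this
  let KC := P.res hPK (⊤ : IntermediateField K L)
  let KB := P.res hP F
  have hKC : ∀ w : P.O, P.ρ w ∈ KC := fun w => ⟨w, trivial, rfl⟩
  let φ : KB →+* KC :=
    { toFun := fun z => ⟨z, by obtain ⟨w, -, h⟩ := z.2; exact ⟨w, trivial, h⟩⟩
      map_one' := rfl
      map_zero' := rfl
      map_mul' := fun _ _ => rfl
      map_add' := fun _ _ => rfl }
  letI : Algebra KB KC := φ.toAlgebra
  haveI : IsScalarTower k KB KC := IsScalarTower.of_algebraMap_eq fun c => Subtype.ext rfl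
  haveI : IsScalarTower KB KC Ω := IsScalarTower.of_algebraMap_eq fun c => rfl
  have hle : KC ≤ K' := by
    rintro _ ⟨w, -, rfl⟩
    exact hK' w
  haveI : FiniteDimensional K KC :=
    FiniteDimensional.of_injective (IntermediateField.inclusion hle).toLinearMap
      (IntermediateField.inclusion_injective hle)
  haveI : Algebra.IsSeparable K KC := Algebra.IsSeparable.of_algHom _ _ (IntermediateField.inclusion hle)
  let tC : KC := ⟨P.ρ t', hKC t'⟩
  have htC : Transcendental KB tC := by
    intro h
    exact htt (h.algebraMap (A := Ω))
  refine finish KB KC tC htC (e := e) ?_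
  intro w
  choose v _ hv using fun i => (w i).2
  obtain ⟨p, hp, h0⟩ := P.dependent hP F t' H v
  refine ⟨p, hp, ?_⟩
  apply (algebraMap KC Ω).injective
  rw [map_sum, map_zero, ← h0]
  refine Finset.sum_congr rfl fun i _ => ?_
  rw [map_mul, hv, ← aeval_algebraMap_apply]
  rfl

theorem aeval_range_eq {k : Type*} {B L : Type*} [Field k] [Field B] [Field L] [Algebra k L]
    (σ : RatFunc B →+* L) (F : IntermediateField k L) (φ : B →+* F)
    (hφ : ∀ b, (φ b : L) = σ (RatFunc.C b)) (p : B[X]) :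
    aeval (σ RatFunc.X) (p.map φ) = σ (algebraMap B[X] (RatFunc B) p) := by
  induction p using Polynomial.induction_on' with
  | add p q hp hq => simp [Polynomial.map_add, hp, hq]
  | monomial n a =>
    rw [Polynomial.map_monomial, aeval_monomial, ← C_mul_X_pow_eq_monomial, map_mul, map_mul,
      map_pow, map_pow, RatFunc.algebraMap_C, RatFunc.algebraMap_X, ← hφ]
    rfl

theorem transcendental_range {k : Type*} {B L : Type*} [Field k] [Field B] [Field L] [Algebra k L]
    (σ : RatFunc B →+* L) (F : IntermediateField k L) (φ : B →+* F)
    (hφ : ∀ b, (φ b : L) = σ (RatFunc.C b)) (hs : Function.Surjective φ) :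
    Transcendental F (σ RatFunc.X) := by
  rw [transcendental_iff]
  intro p hp
  obtain ⟨q, rfl⟩ := Polynomial.map_surjective φ hs p
  rw [aeval_range_eq σ F φ hφ, map_eq_zero_iff _ σ.injective,
    map_eq_zero_iff _ (RatFunc.algebraMap_injective B)] at hp
  simp [hp]

theorem relation_range {k : Type*} {B L : Type*} [Field k] [Field B] [Field L] [Algebra k L]
    (σ : RatFunc B →+* L) (F : IntermediateField k L) (φ : B →+* F)
    (hφ : ∀ b, (φ b : L) = σ (RatFunc.C b)) {e : ℕ} (he : 0 < e)
    (hr : letI := σ.toAlgebra; Module.finrank (RatFunc B) L = e) (w : Fin (e + 1) → L) :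
    ∃ p : Fin (e + 1) → F[X], (∃ i, p i ≠ 0) ∧ ∑ i, aeval (σ RatFunc.X) (p i) * w i = 0 := by
  letI := σ.toAlgebra
  letI : Algebra B[X] L := (σ.comp (algebraMap B[X] (RatFunc B))).toAlgebra
  haveI : IsScalarTower B[X] (RatFunc B) L := IsScalarTower.of_algebraMap_eq' rfl
  replace hr : Module.finrank (RatFunc B) L = e := hr
  haveI : Module.Finite (RatFunc B) L := Module.finite_of_finrank_pos (by omega)
  have hn : ¬ LinearIndependent (RatFunc B) w := fun h => by
    have := h.fintype_card_le_finrank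
    simp [hr] at this
  rw [← LinearIndependent.iff_fractionRing B[X] (RatFunc B),
    Fintype.not_linearIndependent_iff] at hn
  obtain ⟨g, hg, i, hi⟩ := hn
  refine ⟨fun i => (g i).map φ, ⟨i, fun h => hi ?_⟩, ?_⟩
  · exact (Polynomial.map_eq_zero_iff φ.injective).mp h
  · rw [← hg]
    refine Finset.sum_congr rfl fun i _ => ?_
    rw [aeval_range_eq σ F φ hφ, Algebra.smul_def]
    rfl

theorem backward {k : Type u} {K : Type v} [Field k] [Field K] [Algebra k K]
    (hK : IsAlgFunctionField k K) {e : ℕ} (he : 0 < e)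
    (h : letI := ratFuncAlgebra k K; HasSepCvgDiagram (RatFunc k) (RatFunc K) e) :
    ∃ e', 0 < e' ∧ e' ≤ e ∧ HasSepCvgDiagram k K e' := by
  letI := ratFuncAlgebra k K
  obtain ⟨B, L, _, _, aB, aL, hB, hL, f, π, hf, hs, hr⟩ := h
  letI iKL : Algebra (RatFunc K) L := f.toRingHom.toAlgebra
  haveI : FiniteDimensional (RatFunc K) L := hf
  haveI : Algebra.IsSeparable (RatFunc K) L := hs
  letI ikL : Algebra k L := ((algebraMap (RatFunc k) L).comp RatFunc.C).toAlgebra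
  letI iL : Algebra K L := (f.toRingHom.comp RatFunc.C).toAlgebra
  haveI : Algebra.EssFiniteType k K := IntermediateField.fg_top_iff.mp hK
  have hπ : ∀ a : RatFunc k, algebraMap (RatFunc k) L a =
      π (RatFunc.C (algebraMap (RatFunc k) B a)) := fun a => by
    rw [← π.commutes, IsScalarTower.algebraMap_apply (RatFunc k) B (RatFunc B),
      RatFunc.algebraMap_eq_C]
  haveI : IsScalarTower k K L := IsScalarTower.of_algebraMap_eq fun c => by
    change algebraMap (RatFunc k) L (RatFunc.C c) = f (RatFunc.C (algebraMap k K c))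
    rw [← f.commutes, ratFuncAlgebra_algebraMap, rmap_C]
  let F : IntermediateField k L := ((π.toRingHom.comp RatFunc.C).fieldRange).toIntermediateField
    fun c => ⟨algebraMap (RatFunc k) B (RatFunc.C c), (hπ _).symm⟩
  let φ : B →+* F := (π.toRingHom.comp RatFunc.C).codRestrict F.toSubfield fun b => ⟨b, rfl⟩
  have hφ : ∀ b, (φ b : L) = π.toRingHom (RatFunc.C b) := fun b => rfl
  have hφs : Function.Surjective φ := by
    rintro ⟨_, b, rfl⟩
    exact ⟨b, rfl⟩
  haveI : IsScalarTower k K (AlgebraicClosure L) := inferInstance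
  refine core (k := k) (K := K) (L := L) (Ω := AlgebraicClosure L) (fun c => rfl) F ?_
    (π.toRingHom RatFunc.X) (transcendental_range π.toRingHom F φ hφ hφs) (e := e)
    (relation_range π.toRingHom F φ hφ he hr)
  refine ⟨algebraMap (RatFunc k) B RatFunc.X, ?_⟩
  change π (RatFunc.C _) = f RatFunc.X
  rw [← hπ, ← f.commutes, ratFuncAlgebra_algebraMap, rmap_X]

theorem main9 (k : Type u) (K : Type v) [Field k] [Field K] [Algebra k K]
    (hK : IsAlgFunctionField k K) :
    letI := ratFuncAlgebra k K
    scvg (RatFunc k) (RatFunc K) = scvg k K := by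
  letI := ratFuncAlgebra k K
  change sInf {e : ℕ | 0 < e ∧ HasSepCvgDiagram (RatFunc k) (RatFunc K) e} =
    sInf {e : ℕ | 0 < e ∧ HasSepCvgDiagram k K e}
  rcases Set.eq_empty_or_nonempty {e : ℕ | 0 < e ∧ HasSepCvgDiagram k K e} with h | h
  · rw [h]
    congr 1
    rw [Set.eq_empty_iff_forall_notMem] at h ⊢
    rintro e ⟨he, hd⟩
    obtain ⟨e', h1, _, h2⟩ := backward hK he hd
    exact h e' ⟨h1, h2⟩
  · have hsub : ∀ e, (0 < e ∧ HasSepCvgDiagram k K e) →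
        (0 < e ∧ HasSepCvgDiagram (RatFunc k) (RatFunc K) e) :=
      fun e he => ⟨he.1, forward he.1 he.2⟩
    have hne : {e : ℕ | 0 < e ∧ HasSepCvgDiagram (RatFunc k) (RatFunc K) e}.Nonempty :=
      h.imp hsub
    apply le_antisymm
    · exact Nat.sInf_le (hsub _ (Nat.sInf_mem h))
    · obtain ⟨h0, hd⟩ := Nat.sInf_mem hne
      obtain ⟨e', h1, h2, h3⟩ := backward hK h0 hd
      have h4 : e' ∈ {e : ℕ | 0 < e ∧ HasSepCvgDiagram k K e} := ⟨h1, h3⟩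
      exact (Nat.sInf_le h4).trans h2

end Auxiliary

attribute [local instance] ratFuncAlgebra

/-- If the field of constants of `K/k` is `k`, then `scvg_{k(x)}(K(x)) = scvg_k(K)`. -/
theorem stmt9 (k : Type u) (K : Type v) [Field k] [Field K] [Algebra k K]
    (hK : IsAlgFunctionField k K) (hconst : algebraicClosure k K = ⊥) :
    scvg (RatFunc k) (RatFunc K) = scvg k K := by
  exact main9 k K hK
end
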